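/- arXiv:2111.14432 — 5 statements merged into one kernel-verified Lean document; each statement's English description precedes it below -/
import Mathlib

section
/- Let n be even. Then the rank of the semigroup IF_n, i.e. the minimal cardinality of a subset A ⊆ IF_n with ⟨A⟩ = IF_n, equals n + 1. -/
/-!
Common framework: partial injections on `X_n = {1, …, n}`, the fence order,
fence-preserving partial injections, the semigroups `PFI_n`, `IF_n`,
the set `J` of elements of rank at least `n - 2`, and (for even `n`)
the generating system `G`.
-/

namespace FencePaper

/-- The fence (zigzag) order on `{1, …, n}`: `a <_f b` iff `|a - b| = 1` and `b` is even. -/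
def fenceLt (a b : ℕ) : Prop := (a + 1 = b ∨ b + 1 = a) ∧ Even b

/-- A partial injection of `X_n = {1, …, n}`, given by its graph. -/
structure PartialInj (n : ℕ) where
  graph : Set (ℕ × ℕ)
  mem_le : ∀ p ∈ graph, 1 ≤ p.1 ∧ p.1 ≤ n ∧ 1 ≤ p.2 ∧ p.2 ≤ n
  functional : ∀ p ∈ graph, ∀ q ∈ graph, p.1 = q.1 → p.2 = q.2
  injOn : ∀ p ∈ graph, ∀ q ∈ graph, p.2 = q.2 → p.1 = q.1

namespace PartialInj

variable {n : ℕ}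

theorem ext' {α β : PartialInj n} (h : α.graph = β.graph) : α = β := by
  cases α
  cases β
  simp only at h
  subst h
  rfl

/-- The domain of a partial injection. -/
def dom (α : PartialInj n) : Set ℕ := {x | ∃ y, (x, y) ∈ α.graph}

/-- The image (range) of a partial injection. -/
def im (α : PartialInj n) : Set ℕ := {y | ∃ x, (x, y) ∈ α.graph}

/-- The rank of a partial injection: the cardinality of its image. -/
noncomputable def rank (α : PartialInj n) : ℕ := α.im.ncard

/-- The inverse partial injection. -/
def inv (α : PartialInj n) : PartialInj n where
  graph := {p | (p.2, p.1) ∈ α.graph}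
  mem_le := by
    rintro p hp
    obtain ⟨h1, h2, h3, h4⟩ := α.mem_le _ hp
    exact ⟨h3, h4, h1, h2⟩
  functional := by
    rintro p hp q hq h
    exact α.injOn _ hp _ hq h
  injOn := by
    rintro p hp q hq h
    exact α.functional _ hp _ hq h

/-- Composition: first `α`, then `β` (maps act on the right). -/
def comp (α β : PartialInj n) : PartialInj n where
  graph := {p | ∃ y, (p.1, y) ∈ α.graph ∧ (y, p.2) ∈ β.graph}
  mem_le := by
    rintro p ⟨y, h1, h2⟩
    obtain ⟨a, b, -, -⟩ := α.mem_le _ h1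
    obtain ⟨-, -, c, d⟩ := β.mem_le _ h2
    exact ⟨a, b, c, d⟩
  functional := by
    rintro p ⟨y, h1, h2⟩ q ⟨z, h3, h4⟩ h
    have hyz : y = z := α.functional _ h1 _ h3 h
    subst hyz
    exact β.functional (y, p.2) h2 (y, q.2) h4 rfl
  injOn := by
    rintro p ⟨y, h1, h2⟩ q ⟨z, h3, h4⟩ h
    have hyz : y = z := β.injOn _ h2 _ h4 h
    subst hyz
    exact α.injOn (p.1, y) h1 (q.1, y) h3 rfl

/-- The partial identity map on `D ∩ {1, …, n}`. -/
def pid (n : ℕ) (D : Set ℕ) : PartialInj n where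
  graph := {p | p.1 ∈ Set.Icc 1 n ∧ p.1 ∈ D ∧ p.2 = p.1}
  mem_le := by
    rintro p ⟨⟨h1, h2⟩, -, h3⟩
    refine ⟨h1, h2, ?_, ?_⟩ <;> omega
  functional := by
    rintro p ⟨-, -, h1⟩ q ⟨-, -, h2⟩ h
    rw [h1, h2, h]
  injOn := by
    rintro p ⟨-, -, h1⟩ q ⟨-, -, h2⟩ h
    rw [← h1, ← h2, h]

instance : Monoid (PartialInj n) where
  mul := comp
  one := pid n (Set.Icc 1 n)
  mul_assoc a b c := by
    apply ext'
    ext q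
    constructor
    · rintro ⟨y, ⟨z, h1, h2⟩, h3⟩
      exact ⟨z, h1, y, h2, h3⟩
    · rintro ⟨z, h1, y, h2, h3⟩
      exact ⟨y, ⟨z, h1, h2⟩, h3⟩
  one_mul a := by
    apply ext'
    ext q
    constructor
    · rintro ⟨y, ⟨-, -, h⟩, h2⟩
      have hy : y = q.1 := h
      rw [hy] at h2
      exact h2
    · intro hq
      obtain ⟨h1, h2, -, -⟩ := a.mem_le _ hq
      exact ⟨q.1, ⟨⟨h1, h2⟩, ⟨h1, h2⟩, rfl⟩, hq⟩
  mul_one a := by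
    apply ext'
    ext q
    constructor
    · rintro ⟨y, h1, ⟨-, -, h⟩⟩
      have hy : q.2 = y := h
      rw [← hy] at h1
      exact h1
    · intro hq
      obtain ⟨-, -, h3, h4⟩ := a.mem_le _ hq
      exact ⟨q.2, hq, ⟨h3, h4⟩, ⟨h3, h4⟩, rfl⟩

theorem mul_graph (α β : PartialInj n) :
    (α * β).graph = {p | ∃ y, (p.1, y) ∈ α.graph ∧ (y, p.2) ∈ β.graph} := rfl

/-- `α` is fence-preserving. -/
def FP (α : PartialInj n) : Prop :=
  ∀ p ∈ α.graph, ∀ q ∈ α.graph, fenceLt p.1 q.1 → fenceLt p.2 q.2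

/-- The image of a subset under a partial injection. -/
def imageOf (α : PartialInj n) (S : Set ℕ) : Set ℕ := {y | ∃ x ∈ S, (x, y) ∈ α.graph}

end PartialInj

open PartialInj

/-- `PFI_n`: the semigroup of all fence-preserving partial injections. -/
def PFIset (n : ℕ) : Set (PartialInj n) := {α | α.FP}

/-- `IF_n = {α ∈ PFI_n : α⁻¹ ∈ PFI_n}`. -/
def IFset (n : ℕ) : Set (PartialInj n) := {α | α.FP ∧ α.inv.FP}

/-- `J = {α ∈ IF_n : rank α ≥ n - 2}`. -/
def Jset (n : ℕ) : Set (PartialInj n) := {α | α ∈ IFset n ∧ n - 2 ≤ α.rank}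

/-- `A` is a maximal block of consecutive integers of `D ⊆ {1, …, n}`. -/
def IsBlock (n : ℕ) (D A : Set ℕ) : Prop :=
  ∃ i r : ℕ, 1 ≤ i ∧ A = Set.Icc i (i + r) ∧ A ⊆ D ∧
    (i = 1 ∨ i - 1 ∉ D) ∧ (i + r = n ∨ i + r + 1 ∉ D)

/-- `α(k)`: the maximal blocks of `dom α` of cardinality `k`. -/
def blockSet {n : ℕ} (α : PartialInj n) (k : ℕ) : Set (Set ℕ) :=
  {A | IsBlock n α.dom A ∧ A.ncard = k}

/-- `α°(2k+1)`: the maximal blocks `{i, …, i+2k}` of `dom α` with `i` odd. -/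
def oddBlockSet {n : ℕ} (α : PartialInj n) (k : ℕ) : Set (Set ℕ) :=
  {A | A ∈ blockSet α (2 * k + 1) ∧ Odd (sInf A)}

/-- The graph of `σ₁`: domain `X_n ∖ {2}`, `1 ↦ n`, `x ↦ x - 2` for `3 ≤ x ≤ n`. -/
def sigma1Graph (n : ℕ) : Set (ℕ × ℕ) :=
  {q | 1 ≤ q.1 ∧ q.1 ≤ n ∧ q.1 ≠ 2 ∧ q.2 = if q.1 = 1 then n else q.1 - 2}

/-- The graph of `σ₂ = σ₁⁻¹`: domain `X_n ∖ {n-1}`, `x ↦ x + 2` for `x ≤ n - 2`, `n ↦ 1`. -/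
def sigma2Graph (n : ℕ) : Set (ℕ × ℕ) :=
  {q | 1 ≤ q.1 ∧ q.1 ≤ n ∧ q.1 ≠ n - 1 ∧ q.2 = if q.1 = n then 1 else q.1 + 2}

/-- The graph of `γ_i`: domain `X_n ∖ {i}`, `x ↦ i - x` for `x < i`, `x ↦ x` for `x > i`. -/
def gammaGraph (n i : ℕ) : Set (ℕ × ℕ) :=
  {q | 1 ≤ q.1 ∧ q.1 ≤ n ∧ q.1 ≠ i ∧ q.2 = if q.1 < i then i - q.1 else q.1}

/-- The graph of `δ_i`: domain `X_n ∖ {i}`, `x ↦ x` for `x < i`, `x ↦ n + i + 1 - x` for `x > i`. -/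
def deltaGraph (n i : ℕ) : Set (ℕ × ℕ) :=
  {q | 1 ≤ q.1 ∧ q.1 ≤ n ∧ q.1 ≠ i ∧ q.2 = if q.1 < i then q.1 else n + i + 1 - q.1}

/-- The graph of `β_{i,j}`: domain `X_n ∖ {i, j}`, reversing the interval strictly
between `i` and `j` and fixing everything else. -/
def betaGraph (n i j : ℕ) : Set (ℕ × ℕ) :=
  {q | 1 ≤ q.1 ∧ q.1 ≤ n ∧ q.1 ≠ i ∧ q.1 ≠ j ∧
    q.2 = if i < q.1 ∧ q.1 < j then i + j - q.1 else q.1}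

/-- The generating system `G` (for even `n`), given elements `σ₁, σ₂` and families
`γ, δ` realizing the prescribed graphs. -/
def Gset (n : ℕ) (σ₁ σ₂ : PartialInj n) (γ δ : ℕ → PartialInj n) : Set (PartialInj n) :=
  {pid n (Set.Icc 1 n), σ₁, σ₂} ∪
    {g | ∃ i, Even i ∧ 4 ≤ i ∧ i ≤ n ∧ g = γ i} ∪
    {g | ∃ i, Odd i ∧ i ≤ n - 3 ∧ g = δ i}

section Basic

variable {n : ℕ} {α β : PartialInj n} {i j x y x' y' : ℕ}

theorem PartialInj.ext_mem (h : ∀ x y, (x, y) ∈ α.graph ↔ (x, y) ∈ β.graph) : α = β :=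
  ext' (Set.ext fun p => h p.1 p.2)

theorem PartialInj.right_unique (h : (x, y) ∈ α.graph) (h' : (x, y') ∈ α.graph) : y = y' :=
  α.functional _ h _ h' rfl

theorem PartialInj.left_unique (h : (x, y) ∈ α.graph) (h' : (x', y) ∈ α.graph) : x = x' :=
  α.injOn _ h _ h' rfl

theorem PartialInj.bounds (h : (x, y) ∈ α.graph) : 1 ≤ x ∧ x ≤ n ∧ 1 ≤ y ∧ y ≤ n :=
  α.mem_le _ h

theorem PartialInj.mem_mul : (x, y) ∈ (α * β).graph ↔ ∃ z, (x, z) ∈ α.graph ∧ (z, y) ∈ β.graph :=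
  Iff.rfl

theorem PartialInj.mem_inv : (x, y) ∈ α.inv.graph ↔ (y, x) ∈ α.graph := Iff.rfl

theorem PartialInj.mem_one : (x, y) ∈ (1 : PartialInj n).graph ↔ 1 ≤ x ∧ x ≤ n ∧ y = x :=
  ⟨fun ⟨h, _, h'⟩ => ⟨h.1, h.2, h'⟩, fun ⟨h, h', e⟩ => ⟨⟨h, h'⟩, ⟨h, h'⟩, e⟩⟩

theorem PartialInj.mem_pid {D : Set ℕ} :
    (x, y) ∈ (pid n D).graph ↔ 1 ≤ x ∧ x ≤ n ∧ x ∈ D ∧ y = x :=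
  ⟨fun ⟨h, h', e⟩ => ⟨h.1, h.2, h', e⟩, fun ⟨h, h', d, e⟩ => ⟨⟨h, h'⟩, d, e⟩⟩

theorem PartialInj.inv_mul : (α * β).inv = β.inv * α.inv :=
  ext_mem fun _ _ => exists_congr fun _ => and_comm

theorem PartialInj.mul_inv_mul_cancel (h : ∀ x y, (x, y) ∈ α.graph → ∃ z, (x, z) ∈ β.graph) :
    β * (β.inv * α) = α := by
  refine ext_mem fun x y => ⟨?_, fun hx => ?_⟩
  · rintro ⟨z, hz, w, hw, hwy⟩
    obtain rfl := left_unique hz hw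
    exact hwy
  · obtain ⟨z, hz⟩ := h x y hx
    exact ⟨z, hz, x, hz, hx⟩

theorem mem_IFset_iff : α ∈ IFset n ↔ ∀ x y x' y', (x, y) ∈ α.graph → (x', y') ∈ α.graph →
    (fenceLt x x' ↔ fenceLt y y') :=
  ⟨fun h _ _ _ _ hx hx' => ⟨h.1 _ hx _ hx', h.2 (_, _) hx (_, _) hx'⟩,
    fun h => ⟨fun _ hp _ hq => (h _ _ _ _ hp hq).1, fun _ hp _ hq => (h _ _ _ _ hp hq).2⟩⟩

theorem adjacent_iff (hα : α ∈ IFset n) (h : (x, y) ∈ α.graph) (h' : (x', y') ∈ α.graph) :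
    (x + 1 = x' ∨ x' + 1 = x) ↔ (y + 1 = y' ∨ y' + 1 = y) := by
  have h1 := mem_IFset_iff.1 hα _ _ _ _ h h'
  have h2 := mem_IFset_iff.1 hα _ _ _ _ h' h
  simp only [fenceLt, Nat.even_iff] at h1 h2
  omega

theorem mod_two_eq_of_adjacent (hα : α ∈ IFset n) (h : (x, y) ∈ α.graph)
    (h' : (x', y') ∈ α.graph) (hx : x + 1 = x' ∨ x' + 1 = x) : x % 2 = y % 2 := by
  have h1 := mem_IFset_iff.1 hα _ _ _ _ h h'
  have h2 := mem_IFset_iff.1 hα _ _ _ _ h' h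
  simp only [fenceLt, Nat.even_iff] at h1 h2
  omega

theorem one_mem_IFset : (1 : PartialInj n) ∈ IFset n := by
  refine mem_IFset_iff.2 fun x y x' y' h h' => ?_
  rw [mem_one] at h h'
  rw [h.2.2, h'.2.2]

theorem inv_mem_IFset (hα : α ∈ IFset n) : α.inv ∈ IFset n := ⟨hα.2, hα.1⟩

theorem mul_mem_IFset (hα : α ∈ IFset n) (hβ : β ∈ IFset n) : α * β ∈ IFset n := by
  rw [mem_IFset_iff] at *
  rintro x y x' y' ⟨z, h1, h2⟩ ⟨z', h1', h2'⟩
  exact (hα _ _ _ _ h1 h1').trans (hβ _ _ _ _ h2 h2')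

/-- The involution of `ℕ` reversing the open interval between `i` and `j`. -/
def flip (i j x : ℕ) : ℕ := if i < x ∧ x < j then i + j - x else x

theorem flip_flip (i j x : ℕ) : flip i j (flip i j x) = x := by
  unfold flip
  split_ifs <;> omega

theorem flip_eq (i j x : ℕ) :
    i < x ∧ x < j ∧ flip i j x = i + j - x ∨ (x ≤ i ∨ j ≤ x) ∧ flip i j x = x := by
  unfold flip
  split_ifs <;> omega

/-- The partial injection reversing the open interval between `i` and `j`, undefined at `i` and
`j`, and fixing everything else. -/
def rev (n i j : ℕ) : PartialInj n where
  graph := {q | (1 ≤ q.1 ∧ q.1 ≤ n ∧ 1 ≤ q.2 ∧ q.2 ≤ n) ∧ q.1 ≠ i ∧ q.1 ≠ j ∧ q.2 = flip i j q.1}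
  mem_le _ h := h.1
  functional := by
    rintro p ⟨-, -, -, h⟩ q ⟨-, -, -, h'⟩ e
    rw [h, h', e]
  injOn := by
    rintro p ⟨-, -, -, h⟩ q ⟨-, -, -, h'⟩ e
    rw [← flip_flip i j p.1, ← h, e, h', flip_flip]

theorem mem_rev : (x, y) ∈ (rev n i j).graph ↔
    (1 ≤ x ∧ x ≤ n ∧ 1 ≤ y ∧ y ≤ n) ∧ x ≠ i ∧ x ≠ j ∧ y = flip i j x := Iff.rfl

theorem inv_rev : (rev n i j).inv = rev n i j := by
  refine PartialInj.ext_mem fun x y => ?_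
  rw [mem_inv, mem_rev, mem_rev]
  have h1 := flip_flip i j x
  have h2 := flip_flip i j y
  have h3 := flip_eq i j x
  have h4 := flip_eq i j y
  constructor <;> rintro ⟨_, _, _, rfl⟩ <;> omega

theorem rev_mem_IFset (h : i % 2 = j % 2) : rev n i j ∈ IFset n := by
  refine mem_IFset_iff.2 fun x y x' y' h1 h2 => ?_
  rw [mem_rev] at h1 h2
  have h3 := flip_eq i j x
  have h4 := flip_eq i j x'
  simp only [fenceLt, Nat.even_iff]
  omega

/-- The partial injection `σ₁`. -/
def shift (n : ℕ) : PartialInj n where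
  graph := sigma1Graph n
  mem_le := by
    rintro ⟨x, y⟩ ⟨h1, h2, h3, h4⟩
    dsimp only at *
    split_ifs at h4 <;> omega
  functional := by
    rintro p ⟨-, -, -, h⟩ q ⟨-, -, -, h'⟩ e
    rw [h, h', e]
  injOn := by
    rintro ⟨x, y⟩ ⟨h1, h2, h3, h4⟩ ⟨x', y'⟩ ⟨h1', h2', h3', h4'⟩ e
    dsimp only at *
    split_ifs at h4 h4' <;> omega

theorem mem_shift : (x, y) ∈ (shift n).graph ↔
    1 ≤ x ∧ x ≤ n ∧ (x = 1 ∧ y = n ∨ 3 ≤ x ∧ y + 2 = x) := by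
  change (1 ≤ x ∧ x ≤ n ∧ x ≠ 2 ∧ y = if x = 1 then n else x - 2) ↔ _
  split_ifs <;> omega

theorem shift_mem_IFset (hn : Even n) : shift n ∈ IFset n := by
  refine mem_IFset_iff.2 fun x y x' y' h1 h2 => ?_
  rw [mem_shift] at h1 h2
  simp only [fenceLt, Nat.even_iff] at *
  omega

/-- The generator of `IF_n` whose domain is `X_n ∖ {i}`. -/
def generator (n i : ℕ) : PartialInj n :=
  if i = 0 then 1
  else if i = 2 then shift n
  else if i + 1 = n then (shift n).inv
  else if Even i then rev n 0 i
  else rev n i (n + 1)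

theorem generator_cases (hn : Even n) (hi : i ≤ n) :
    (i = 0 ∧ generator n i = 1) ∨ (i = 2 ∧ generator n i = shift n) ∨
    (i + 1 = n ∧ generator n i = (shift n).inv) ∨
    (i % 2 = 0 ∧ 4 ≤ i ∧ generator n i = rev n 0 i) ∨
    (i % 2 = 1 ∧ i + 3 ≤ n ∧ generator n i = rev n i (n + 1)) := by
  unfold generator
  simp only [Nat.even_iff] at *
  split_ifs <;> simp_all <;> omega

theorem generator_mem_IFset (hn : Even n) (hi : i ≤ n) : generator n i ∈ IFset n := by
  have hn' := Nat.even_iff.1 hn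
  rcases generator_cases hn hi with ⟨_, h⟩ | ⟨_, h⟩ | ⟨_, h⟩ | ⟨_, _, h⟩ | ⟨_, _, h⟩ <;> rw [h]
  · exact one_mem_IFset
  · exact shift_mem_IFset hn
  · exact inv_mem_IFset (shift_mem_IFset hn)
  · exact rev_mem_IFset (by omega)
  · exact rev_mem_IFset (by omega)

theorem mem_dom_generator (hn : Even n) (hi : i ≤ n) :
    x ∈ (generator n i).dom ↔ 1 ≤ x ∧ x ≤ n ∧ x ≠ i := by
  have hn' := Nat.even_iff.1 hn
  simp only [dom, Set.mem_ofPred_eq]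
  rcases generator_cases hn hi with ⟨h', h⟩ | ⟨h', h⟩ | ⟨h', h⟩ | ⟨h', _, h⟩ | ⟨h', _, h⟩ <;> rw [h]
  · simp only [mem_one]
    exact ⟨fun ⟨y, hy⟩ => by omega, fun hx => ⟨x, by omega⟩⟩
  · simp only [mem_shift]
    exact ⟨fun ⟨y, hy⟩ => by omega, fun hx => ⟨if x = 1 then n else x - 2, by split_ifs <;> omega⟩⟩
  · simp only [mem_inv, mem_shift]
    exact ⟨fun ⟨y, hy⟩ => by omega, fun hx => ⟨if x = n then 1 else x + 2, by split_ifs <;> omega⟩⟩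
  · simp only [mem_rev]
    have := flip_eq 0 i x
    exact ⟨fun ⟨y, hy⟩ => by omega, fun hx => ⟨flip 0 i x, by omega⟩⟩
  · simp only [mem_rev]
    have := flip_eq i (n + 1) x
    exact ⟨fun ⟨y, hy⟩ => by omega, fun hx => ⟨flip i (n + 1) x, by omega⟩⟩

theorem generator_injOn (hn : Even n) : Set.InjOn (generator n) (Set.Iic n) := by
  intro i hi j hj h
  rw [Set.mem_Iic] at hi hj
  have hi' := fun x => mem_dom_generator (x := x) hn hi
  have hj' := fun x => mem_dom_generator (x := x) hn hj
  rw [h] at hi'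
  have h1 := (hi' i).symm.trans (hj' i)
  have h2 := (hi' j).symm.trans (hj' j)
  omega

end Basic

section Generated

variable {n : ℕ} {α β : PartialInj n} {i j : ℕ}

/-- The subsemigroup generated by the elements `generator n i`. -/
def generated (n : ℕ) : Subsemigroup (PartialInj n) :=
  Subsemigroup.closure (generator n '' Set.Iic n)

theorem generator_mem_generated (hi : i ≤ n) : generator n i ∈ generated n :=
  Subsemigroup.subset_closure ⟨i, hi, rfl⟩

theorem mem_IFset_of_mem_generated (hn : Even n) (h : α ∈ generated n) : α ∈ IFset n := by
  induction h using Subsemigroup.closure_induction with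
  | mem x hx =>
    obtain ⟨i, hi, rfl⟩ := hx
    exact generator_mem_IFset hn hi
  | mul x y _ _ hx hy => exact mul_mem_IFset hx hy

theorem one_mem_generated : (1 : PartialInj n) ∈ generated n :=
  generator_mem_generated (Nat.zero_le n)

theorem shift_mem_generated (hn : Even n) (hn0 : 0 < n) : shift n ∈ generated n := by
  have hn' := Nat.even_iff.1 hn
  have h2 : 2 ≤ n := by omega
  have h : generator n 2 = shift n := by simp [generator]
  exact h ▸ generator_mem_generated h2

theorem inv_shift_mem_generated (hn : Even n) (hn0 : 0 < n) : (shift n).inv ∈ generated n := by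
  have hn' := Nat.even_iff.1 hn
  rcases generator_cases (i := n - 1) hn (by omega) with h | h | h | h | h
  all_goals first
    | (exfalso; omega)
    | exact h.2 ▸ generator_mem_generated (by omega)

theorem rev_zero_mem_generated (hn : Even n) (hi : i % 2 = 0) (hi0 : 0 < i) (hin : i ≤ n) :
    rev n 0 i ∈ generated n := by
  have hn' := Nat.even_iff.1 hn
  by_cases h2 : i = 2
  · have h : rev n 0 2 = shift n * (shift n).inv := by
      refine PartialInj.ext_mem fun x y => ?_
      simp only [mem_rev, mem_mul, mem_inv, mem_shift]
      have := flip_eq 0 2 x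
      exact ⟨fun h => ⟨if x = 1 then n else x - 2, by split_ifs <;> omega⟩,
        fun ⟨z, hz⟩ => by omega⟩
    rw [h2, h]
    exact mul_mem (shift_mem_generated hn (by omega)) (inv_shift_mem_generated hn (by omega))
  · rcases generator_cases hn hin with h | h | h | h | h
    all_goals first
      | (exfalso; omega)
      | exact h.2.2 ▸ generator_mem_generated (by omega)

theorem rev_last_mem_generated (hn : Even n) (hi : i % 2 = 1) (hin : i ≤ n) :
    rev n i (n + 1) ∈ generated n := by
  have hn' := Nat.even_iff.1 hn
  by_cases h2 : i + 1 = n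
  · have h : rev n i (n + 1) = (shift n).inv * shift n := by
      refine PartialInj.ext_mem fun x y => ?_
      simp only [mem_rev, mem_mul, mem_inv, mem_shift]
      have := flip_eq i (n + 1) x
      exact ⟨fun h => ⟨if x = n then 1 else x + 2, by split_ifs <;> omega⟩,
        fun ⟨z, hz⟩ => by omega⟩
    rw [h]
    exact mul_mem (inv_shift_mem_generated hn (by omega)) (shift_mem_generated hn (by omega))
  · rcases generator_cases hn hin with h | h | h | h | h
    all_goals first
      | (exfalso; omega)
      | exact h.2.2 ▸ generator_mem_generated (by omega)

theorem rev_mem_generated (hn : Even n) (hij : i < j) (hj : j ≤ n + 1) (h : i % 2 = j % 2) :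
    rev n i j ∈ generated n := by
  have hn' := Nat.even_iff.1 hn
  rcases Nat.mod_two_eq_zero_or_one i with hi | hi
  · have h1 := rev_zero_mem_generated (i := j) hn (by omega) (by omega) (by omega)
    by_cases hi0 : i = 0
    · exact hi0 ▸ h1
    have h2 := rev_zero_mem_generated (i := j - i) hn (by omega) (by omega) (by omega)
    have : rev n i j = rev n 0 j * rev n 0 (j - i) * rev n 0 j := by
      refine PartialInj.ext_mem fun x y => ?_
      simp only [mem_rev, mem_mul]
      have e1 := flip_eq 0 j x
      have e2 := flip_eq 0 (j - i) (flip 0 j x)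
      have e3 := flip_eq 0 j (flip 0 (j - i) (flip 0 j x))
      have e4 := flip_eq i j x
      constructor
      · intro h
        exact ⟨flip 0 (j - i) (flip 0 j x), ⟨flip 0 j x, by omega⟩, by omega⟩
      · rintro ⟨z, ⟨w, ⟨_, _, _, rfl⟩, _, _, _, rfl⟩, _, _, _, rfl⟩
        omega
    rw [this]
    exact mul_mem (mul_mem h1 h2) h1
  · have h1 := rev_last_mem_generated (i := i) hn (by omega) (by omega)
    by_cases hj0 : j = n + 1
    · exact hj0 ▸ h1
    have h2 := rev_last_mem_generated (i := n + 1 + i - j) hn (by omega) (by omega)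
    have : rev n i j = rev n i (n + 1) * rev n (n + 1 + i - j) (n + 1) * rev n i (n + 1) := by
      refine PartialInj.ext_mem fun x y => ?_
      simp only [mem_rev, mem_mul]
      have e1 := flip_eq i (n + 1) x
      have e2 := flip_eq (n + 1 + i - j) (n + 1) (flip i (n + 1) x)
      have e3 := flip_eq i (n + 1) (flip (n + 1 + i - j) (n + 1) (flip i (n + 1) x))
      have e4 := flip_eq i j x
      constructor
      · intro h
        exact ⟨flip (n + 1 + i - j) (n + 1) (flip i (n + 1) x), ⟨flip i (n + 1) x, by omega⟩,
          by omega⟩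
      · rintro ⟨z, ⟨w, ⟨_, _, _, rfl⟩, _, _, _, rfl⟩, _, _, _, rfl⟩
        omega
    rw [this]
    exact mul_mem (mul_mem h1 h2) h1

theorem inv_mem_generated (hn : Even n) (h : α ∈ generated n) : α.inv ∈ generated n := by
  induction h using Subsemigroup.closure_induction with
  | mem x hx =>
    obtain ⟨i, hi, rfl⟩ := hx
    have hn' := Nat.even_iff.1 hn
    rw [Set.mem_Iic] at hi
    rcases generator_cases hn hi with h | h | h | h | h
    · have : (1 : PartialInj n).inv = 1 := by
        refine PartialInj.ext_mem fun x y => ?_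
        rw [mem_inv, mem_one, mem_one]
        omega
      rw [h.2, this]
      exact one_mem_generated
    · rw [h.2]
      exact inv_shift_mem_generated hn (by omega)
    · rw [h.2]
      exact shift_mem_generated hn (by omega)
    · rw [h.2.2, inv_rev]
      exact rev_mem_generated hn (by omega) (by omega) (by omega)
    · rw [h.2.2, inv_rev]
      exact rev_mem_generated hn (by omega) (by omega) (by omega)
  | mul x y _ _ hx hy => exact inv_mul (α := x) ▸ mul_mem hy hx

theorem pid_compl_singleton_mem_generated (hn : Even n) (hi0 : 0 < i) (hin : i ≤ n) :
    pid n {i}ᶜ ∈ generated n := by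
  have hn' := Nat.even_iff.1 hn
  rcases Nat.mod_two_eq_zero_or_one i with hi | hi
  · have h1 := rev_zero_mem_generated (i := i) hn hi hi0 hin
    have : pid n {i}ᶜ = rev n 0 i * rev n 0 i := by
      refine PartialInj.ext_mem fun x y => ?_
      simp only [mem_rev, mem_mul, mem_pid, Set.mem_compl_iff, Set.mem_singleton_iff]
      have e1 := flip_eq 0 i x
      have e2 := flip_flip 0 i x
      exact ⟨fun h => ⟨flip 0 i x, by omega⟩, by rintro ⟨z, ⟨_, _, _, rfl⟩, _⟩; omega⟩
    exact this ▸ mul_mem h1 h1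
  · have h1 := rev_last_mem_generated (i := i) hn hi hin
    have : pid n {i}ᶜ = rev n i (n + 1) * rev n i (n + 1) := by
      refine PartialInj.ext_mem fun x y => ?_
      simp only [mem_rev, mem_mul, mem_pid, Set.mem_compl_iff, Set.mem_singleton_iff]
      have e1 := flip_eq i (n + 1) x
      have e2 := flip_flip i (n + 1) x
      exact ⟨fun h => ⟨flip i (n + 1) x, by omega⟩, by rintro ⟨z, ⟨_, _, _, rfl⟩, _⟩; omega⟩
    exact this ▸ mul_mem h1 h1

theorem pid_mem_generated (hn : Even n) (D : Set ℕ) : pid n D ∈ generated n := by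
  have key : ∀ m ≤ n, pid n (D ∪ Set.Ioi m) ∈ generated n := by
    intro m
    induction m with
    | zero =>
      intro _
      have : pid n (D ∪ Set.Ioi 0) = 1 := by
        refine PartialInj.ext_mem fun x y => ?_
        rw [mem_pid, mem_one]
        exact ⟨fun h => ⟨h.1, h.2.1, h.2.2.2⟩, fun h => ⟨h.1, h.2.1, Or.inr h.1, h.2.2⟩⟩
      exact this ▸ one_mem_generated
    | succ m ih =>
      intro hm
      have ih := ih (by omega)
      by_cases hD : m + 1 ∈ D
      · have : D ∪ Set.Ioi (m + 1) = D ∪ Set.Ioi m := by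
          ext x
          simp only [Set.mem_union, Set.mem_Ioi]
          by_cases hx : x = m + 1
          · subst hx
            tauto
          · have : m + 1 < x ↔ m < x := by omega
            rw [this]
        rwa [this]
      · have : pid n (D ∪ Set.Ioi (m + 1)) = pid n (D ∪ Set.Ioi m) * pid n {m + 1}ᶜ := by
          refine PartialInj.ext_mem fun x y => ?_
          simp only [mem_mul, mem_pid, Set.mem_compl_iff, Set.mem_singleton_iff, Set.mem_union,
            Set.mem_Ioi]
          constructor
          · rintro ⟨h1, h2, h3, rfl⟩
            refine ⟨y, ⟨h1, h2, h3.imp_right (by omega), rfl⟩, h1, h2, ?_, rfl⟩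
            rintro rfl
            exact h3.elim hD (lt_irrefl _)
          · rintro ⟨z, ⟨h1, h2, h3, rfl⟩, -, -, h4, rfl⟩
            exact ⟨h1, h2, h3.imp_right (by omega), rfl⟩
        exact this ▸ mul_mem ih (pid_compl_singleton_mem_generated hn m.succ_pos hm)
  have : pid n D = pid n (D ∪ Set.Ioi n) := by
    refine PartialInj.ext_mem fun x y => ?_
    simp only [mem_pid, Set.mem_union, Set.mem_Ioi]
    exact ⟨fun h => ⟨h.1, h.2.1, Or.inl h.2.2.1, h.2.2.2⟩,
      fun h => ⟨h.1, h.2.1, h.2.2.1.resolve_right (by omega), h.2.2.2⟩⟩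
  exact this ▸ key n le_rfl

end Generated

section Runs

variable {n : ℕ} {α : PartialInj n} {h L : ℕ}

/-- An element of `IF_n` maps an interval contained in its domain onto an interval, either
increasingly or decreasingly. -/
theorem image_of_run (hα : α ∈ IFset n) (hL : 2 ≤ L)
    (hdom : ∀ t, 0 < t → t < L → ∃ y, (h + t, y) ∈ α.graph) :
    ∃ u, (∀ t, 0 < t → t < L → (h + t, u + t) ∈ α.graph) ∨
      (∀ t, 0 < t → t < L → (h + t, u + L - t) ∈ α.graph) := by
  induction L, hL using Nat.le_induction with
  | base =>
    obtain ⟨y, hy⟩ := hdom 1 (by omega) (by omega)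
    have hb := bounds hy
    refine ⟨y - 1, Or.inl fun t h0 h1 => ?_⟩
    obtain rfl : t = 1 := by omega
    rwa [Nat.sub_add_cancel (by omega)]
  | succ L hL ih =>
    obtain ⟨y, hy⟩ := hdom L (by omega) (by omega)
    have hb := bounds hy
    obtain ⟨u, hu⟩ := ih fun t h0 h1 => hdom t h0 (by omega)
    have extend : ∀ u', (u' + L = y ∧ ∀ t, 0 < t → t < L → (h + t, u' + t) ∈ α.graph) ∨
        (u' + 1 = y ∧ ∀ t, 0 < t → t < L → (h + t, u' + (L + 1) - t) ∈ α.graph) →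
        ∃ u, (∀ t, 0 < t → t < L + 1 → (h + t, u + t) ∈ α.graph) ∨
          (∀ t, 0 < t → t < L + 1 → (h + t, u + (L + 1) - t) ∈ α.graph) := by
      rintro u' (⟨h1, h2⟩ | ⟨h1, h2⟩)
      · refine ⟨u', Or.inl fun t h0 ht => ?_⟩
        obtain rfl | ht := eq_or_ne t L
        · rwa [h1]
        · exact h2 t h0 (by omega)
      · refine ⟨u', Or.inr fun t h0 ht => ?_⟩
        obtain rfl | ht := eq_or_ne t L
        · rwa [show u' + (t + 1) - t = y by omega]
        · exact h2 t h0 (by omega)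
    rcases hu with hu | hu
    · have h1 := hu (L - 1) (by omega) (by omega)
      have ha := (adjacent_iff hα h1 hy).1 (by omega)
      by_cases hup : u + L = y
      · exact extend u (Or.inl ⟨hup, hu⟩)
      · obtain rfl : L = 2 := by
          by_contra hL2
          have h2 := hu (L - 2) (by omega) (by omega)
          rw [show u + (L - 2) = y by omega] at h2
          have := left_unique h2 hy
          omega
        refine extend (y - 1) (Or.inr ⟨by omega, fun t h0 ht => ?_⟩)
        have h2 := hu t h0 ht
        rwa [show y - 1 + (2 + 1) - t = u + t by omega]
    · have h1 := hu (L - 1) (by omega) (by omega)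
      have ha := (adjacent_iff hα h1 hy).1 (by omega)
      by_cases hup : u = y
      · refine extend (u - 1) (Or.inr ⟨by omega, fun t h0 ht => ?_⟩)
        have h2 := hu t h0 ht
        rwa [show u - 1 + (L + 1) - t = u + L - t by omega]
      · obtain rfl : L = 2 := by
          by_contra hL2
          have h2 := hu (L - 2) (by omega) (by omega)
          rw [show u + L - (L - 2) = y by omega] at h2
          have := left_unique h2 hy
          omega
        refine extend u (Or.inl ⟨by omega, fun t h0 ht => ?_⟩)
        have h2 := hu t h0 ht
        rwa [show u + t = u + 2 - t by omega]

/-- The image of a maximal block of the domain with at least one point is a maximal block of the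
image. -/
theorem image_of_block (hα : α ∈ IFset n) (hL : 2 ≤ L)
    (hdom : ∀ t, 0 < t → t < L → ∃ y, (h + t, y) ∈ α.graph)
    (hh : h ∉ α.dom) (hhL : h + L ∉ α.dom) :
    ∃ u, u ∉ α.im ∧ u + L ∉ α.im ∧ ((∀ t, 0 < t → t < L → (h + t, u + t) ∈ α.graph) ∨
      (∀ t, 0 < t → t < L → (h + t, u + L - t) ∈ α.graph)) := by
  have hne : ∀ z y, (z, y) ∈ α.graph → z ≠ h ∧ z ≠ h + L := by
    rintro z y hz
    constructor <;> rintro rfl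
    exacts [hh ⟨y, hz⟩, hhL ⟨y, hz⟩]
  obtain ⟨u, hu⟩ := image_of_run hα hL hdom
  refine ⟨u, ?_, ?_, hu⟩ <;> rintro ⟨z, hz⟩ <;> have hz' := hne _ _ hz <;>
    rcases hu with hu | hu
  · have h1 := hu 1 (by omega) (by omega)
    have h2 := (adjacent_iff hα h1 hz).2 (by omega)
    have h3 := right_unique hz ((show z = h + 2 by omega) ▸ hu 2 (by omega) (by omega))
    omega
  · have h1 := hu (L - 1) (by omega) (by omega)
    have h2 := (adjacent_iff hα h1 hz).2 (by omega)
    have h3 := right_unique hz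
      ((show z = h + (L - 2) by omega) ▸ hu (L - 2) (by omega) (by omega))
    omega
  · have h1 := hu (L - 1) (by omega) (by omega)
    have h2 := (adjacent_iff hα h1 hz).2 (by omega)
    have h3 := right_unique hz
      ((show z = h + (L - 2) by omega) ▸ hu (L - 2) (by omega) (by omega))
    omega
  · have h1 := hu 1 (by omega) (by omega)
    have h2 := (adjacent_iff hα h1 hz).2 (by omega)
    have h3 := right_unique hz ((show z = h + 2 by omega) ▸ hu 2 (by omega) (by omega))
    omega

theorem exists_next_hole (α : PartialInj n) (hh : h ≤ n) :
    ∃ L, 0 < L ∧ h + L ≤ n + 1 ∧ h + L ∉ α.dom ∧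
      ∀ t, 0 < t → t < L → ∃ y, (h + t, y) ∈ α.graph := by
  classical
  have hex : ∃ L, 0 < L ∧ h + L ∉ α.dom := by
    refine ⟨n + 1 - h, by omega, fun ⟨y, hy⟩ => ?_⟩
    have := bounds hy
    omega
  refine ⟨Nat.find hex, (Nat.find_spec hex).1, ?_, (Nat.find_spec hex).2, fun t h0 ht => ?_⟩
  · have : Nat.find hex ≤ n + 1 - h := Nat.find_min' hex
      ⟨by omega, fun ⟨y, hy⟩ => by have := bounds hy; omega⟩
    omega
  · have := Nat.find_min hex ht
    rw [not_and, not_not] at this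
    exact this h0

end Runs

section Oriented

variable {n : ℕ} {α : PartialInj n} {h L u e i j x y : ℕ}

/-- The elements of `IF_n` which preserve the parity of every point. -/
def parityIF (n : ℕ) : Set (PartialInj n) :=
  {α | α ∈ IFset n ∧ ∀ x y, (x, y) ∈ α.graph → x % 2 = y % 2}

/-- `h` lies outside the domain and the image of `α`, and `α` acts as a partial identity
below `h`. -/
def FixesBelow (α : PartialInj n) (h : ℕ) : Prop :=
  h ∉ α.dom ∧ h ∉ α.im ∧ ∀ x y, (x, y) ∈ α.graph → x < h ∨ y < h → x = y

theorem inv_mem_parityIF (hα : α ∈ parityIF n) : α.inv ∈ parityIF n :=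
  ⟨inv_mem_IFset hα.1, fun x y hx => (hα.2 y x hx).symm⟩

theorem FixesBelow.inv (hα : FixesBelow α h) : FixesBelow α.inv h :=
  ⟨hα.2.1, hα.1, fun x y hx hlt => (hα.2.2 y x hx hlt.symm).symm⟩

theorem mul_rev_mem_parityIF (hα : α ∈ parityIF n) (hp : i % 2 = j % 2) :
    α * rev n i j ∈ parityIF n := by
  refine ⟨mul_mem_IFset hα.1 (rev_mem_IFset hp), ?_⟩
  rintro x y ⟨z, hz, hzy⟩
  have h1 := hα.2 _ _ hz
  rw [mem_rev] at hzy
  have h2 := flip_eq i j z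
  omega

theorem mem_mul_rev (hi : i ∉ α.im) (hj : j ∉ α.im) (hjn : j ≤ n + 1) (hxy : (x, y) ∈ α.graph) :
    (x, flip i j y) ∈ (α * rev n i j).graph := by
  refine ⟨y, hxy, ?_⟩
  have hb := bounds hxy
  have h1 : y ≠ i := fun e => hi ⟨x, e ▸ hxy⟩
  have h2 : y ≠ j := fun e => hj ⟨x, e ▸ hxy⟩
  have h3 := flip_eq i j y
  rw [mem_rev]
  omega

theorem mem_generated_of_mul_rev (hn : Even n) (hij : i < j) (hjn : j ≤ n + 1)
    (hp : i % 2 = j % 2) (hi : i ∉ α.im) (hj : j ∉ α.im) (h : α * rev n i j ∈ generated n) :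
    α ∈ generated n := by
  have h1 : α = α * rev n i j * rev n i j := by
    refine PartialInj.ext_mem fun x y => ⟨fun hx => ?_, ?_⟩
    · have h2 := mem_mul_rev hi hj hjn hx
      refine ⟨_, h2, ?_⟩
      obtain ⟨z, hz, hz'⟩ := h2
      obtain rfl := right_unique hx hz
      rw [← inv_rev]
      exact hz'
    · rintro ⟨z, ⟨w, hw, hwz⟩, hz⟩
      have h2 : y = w := (mem_rev.1 hz).2.2.2.trans
        ((congrArg _ (mem_rev.1 hwz).2.2.2).trans (flip_flip i j w))
      exact h2 ▸ hw
  rw [h1]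
  exact mul_mem h (rev_mem_generated hn hij hjn hp)

theorem mem_generated_of_decreasing (hn : Even n) (hα : α ∈ parityIF n) (hf : FixesBelow α h)
    (hL : 2 ≤ L) (hhL : h + L ∉ α.dom) (hu : u ∉ α.im) (huL : u + L ∉ α.im) (huh : h ≤ u)
    (hp : h % 2 = (u + L) % 2)
    (hrun : ∀ t, 0 < t → t < L → (h + t, u + L - t) ∈ α.graph)
    (next : ∀ β ∈ parityIF n, FixesBelow β (h + L) → β ∈ generated n) : α ∈ generated n := by
  have hun : u + L ≤ n + 1 := by
    have := bounds (hrun 1 (by omega) (by omega))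
    omega
  refine mem_generated_of_mul_rev hn (by omega) hun hp hf.2.1 huL
    (next _ (mul_rev_mem_parityIF hα hp) ⟨?_, ?_, ?_⟩)
  · rintro ⟨y, z, hz, -⟩
    exact hhL ⟨z, hz⟩
  · rintro ⟨x, z, hz, hz'⟩
    rw [mem_rev] at hz'
    have h1 := flip_eq h (u + L) z
    exact hu ⟨x, (show z = u by omega) ▸ hz⟩
  · rintro x y ⟨z, hz, hzy⟩ hlt
    have h0 := hf.2.2 x z hz
    have hxh : x ≠ h := fun e => hf.1 ⟨z, e ▸ hz⟩
    rw [mem_rev] at hzy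
    have h1 := flip_eq h (u + L) z
    by_cases hx : h < x ∧ x < h + L
    · obtain ⟨t, rfl⟩ := Nat.exists_eq_add_of_lt hx.1
      have h2 := right_unique hz (hrun (t + 1) (by omega) (by omega))
      omega
    · by_cases hz2 : u < z ∧ z < u + L
      · obtain ⟨t, h0t, htL, rfl⟩ : ∃ t, 0 < t ∧ t < L ∧ z = u + L - t :=
          ⟨u + L - z, by omega, by omega, by omega⟩
        have h2 := left_unique hz (hrun t h0t htL)
        omega
      · have hzu : z ≠ u := fun e => hu ⟨x, e ▸ hz⟩
        omega

theorem mem_generated_of_increasing (hn : Even n) (hα : α ∈ parityIF n) (hf : FixesBelow α h)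
    (hL : 2 ≤ L) (hhL : h + L ∉ α.dom) (hu : u ∉ α.im) (huL : u + L ∉ α.im)
    (he : e ∉ α.im) (hhe : h ≤ e) (heu : e ≤ u) (hp : e % 2 = (u + L) % 2)
    (hph : h % 2 = u % 2)
    (hrun : ∀ t, 0 < t → t < L → (h + t, u + t) ∈ α.graph)
    (next : ∀ β ∈ parityIF n, FixesBelow β (h + L) → β ∈ generated n) : α ∈ generated n := by
  have hun : u + L ≤ n + 1 := by
    have := bounds (hrun (L - 1) (by omega) (by omega))
    omega
  refine mem_generated_of_mul_rev hn (by omega) hun hp he huL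
    (mem_generated_of_decreasing hn (mul_rev_mem_parityIF hα hp) ⟨?_, ?_, ?_⟩ hL ?_ (u := e)
      ?_ ?_ hhe (by omega) ?_ next)
  · rintro ⟨y, z, hz, -⟩
    exact hf.1 ⟨z, hz⟩
  · rintro ⟨x, z, hz, hz'⟩
    rw [mem_rev] at hz'
    have h1 := flip_eq e (u + L) z
    exact hf.2.1 ⟨x, (show z = h by omega) ▸ hz⟩
  · rintro x y ⟨z, hz, hzy⟩ hlt
    have h0 := hf.2.2 x z hz
    rw [mem_rev] at hzy
    have h1 := flip_eq e (u + L) z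
    omega
  · rintro ⟨y, z, hz, -⟩
    exact hhL ⟨z, hz⟩
  · rintro ⟨x, z, hz, hz'⟩
    rw [mem_rev] at hz'
    have h1 := flip_eq e (u + L) z
    omega
  · rintro ⟨x, z, hz, hz'⟩
    rw [mem_rev] at hz'
    have h1 := flip_eq e (u + L) z
    exact hu ⟨x, (show z = u by omega) ▸ hz⟩
  · intro t h0 ht
    have h1 := mem_mul_rev he huL hun (hrun t h0 ht)
    have h2 := flip_eq e (u + L) (u + t)
    rwa [show e + L - t = flip e (u + L) (u + t) by omega]

theorem mem_generated_of_block (hn : Even n) (hα : α ∈ parityIF n) (hf : FixesBelow α h)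
    (hL : 2 ≤ L) (hhL : h + L ∉ α.dom)
    (hdom : ∀ t, 0 < t → t < L → ∃ y, (h + t, y) ∈ α.graph)
    (he : L % 2 = 0 ∨ ∀ u ∉ α.im, h < u → ∃ e ∉ α.im, h < e ∧ e ≤ u ∧ e % 2 ≠ h % 2)
    (next : ∀ β ∈ parityIF n, FixesBelow β (h + L) → β ∈ generated n) : α ∈ generated n := by
  obtain ⟨u, hu, huL, hrun⟩ := image_of_block hα.1 hL hdom hf.1 hhL
  have hne : ∀ t, 0 < t → (h + t, u + 1) ∈ α.graph → h ≤ u := by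
    intro t h0 ht
    have h1 := hf.2.2 _ _ ht
    have h2 : u + 1 ≠ h := fun e => hf.2.1 ⟨_, e ▸ ht⟩
    omega
  rcases hrun with hrun | hrun
  · have h1 := hrun 1 (by omega) (by omega)
    have hhu := hne 1 (by omega) h1
    have hp := hα.2 _ _ h1
    obtain rfl | hlt := hhu.eq_or_lt
    · refine next α hα ⟨hhL, huL, fun x y hxy hlt => ?_⟩
      have h2 := hf.2.2 x y hxy
      have hx : x ≠ h := fun e => hf.1 ⟨y, e ▸ hxy⟩
      have hy : y ≠ h := fun e => hf.2.1 ⟨x, e ▸ hxy⟩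
      by_cases hxL : h < x ∧ x < h + L
      · obtain ⟨t, rfl⟩ := Nat.exists_eq_add_of_lt hxL.1
        have := right_unique hxy (hrun (t + 1) (by omega) (by omega))
        omega
      · by_cases hyL : h < y ∧ y < h + L
        · obtain ⟨t, rfl⟩ := Nat.exists_eq_add_of_lt hyL.1
          have := left_unique hxy (hrun (t + 1) (by omega) (by omega))
          omega
        · omega
    · by_cases hLp : L % 2 = 0
      · exact mem_generated_of_increasing hn hα hf hL hhL hu huL hu hhu le_rfl (by omega)
          (by omega) hrun next
      · obtain ⟨e, he, h2, h3, h4⟩ := he.resolve_left hLp u hu hlt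
        exact mem_generated_of_increasing hn hα hf hL hhL hu huL he h2.le h3 (by omega)
          (by omega) hrun next
  · have h1 := hrun (L - 1) (by omega) (by omega)
    rw [show u + L - (L - 1) = u + 1 by omega] at h1
    have hhu := hne _ (by omega) h1
    have hp := hα.2 _ _ h1
    exact mem_generated_of_decreasing hn hα hf hL hhL hu huL hhu (by omega) hrun next

theorem mem_generated_of_fixesBelow (hn : Even n) (hα : α ∈ parityIF n) (hf : FixesBelow α h)
    (hh : h ≤ n + 1) : α ∈ generated n := by
  induction hk : n + 1 - h using Nat.strong_induction_on generalizing h α with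
  | _ k ih =>
  obtain rfl | hlt := hh.eq_or_lt
  · have : α = pid n α.dom := by
      refine PartialInj.ext_mem fun x y => ⟨fun hx => ?_, ?_⟩
      · have hb := bounds hx
        exact mem_pid.2 ⟨hb.1, hb.2.1, ⟨y, hx⟩, (hf.2.2 x y hx (by omega)).symm⟩
      · intro hx
        obtain ⟨-, h2, ⟨z, hz⟩, rfl⟩ := mem_pid.1 hx
        have h3 := hf.2.2 _ _ hz (by omega)
        rwa [← h3] at hz
    exact this ▸ pid_mem_generated hn _
  have next : ∀ L, 0 < L → h + L ≤ n + 1 → ∀ β ∈ parityIF n, FixesBelow β (h + L) →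
      β ∈ generated n := fun L h0 hL β hβ hfβ => ih (n + 1 - (h + L)) (by omega) hβ hfβ hL rfl
  have of_inv : α.inv ∈ generated n → α ∈ generated n := fun hi => inv_mem_generated hn hi
  obtain ⟨L, hL0, hL, hhL, hdom⟩ := exists_next_hole α (h := h) (by omega)
  obtain ⟨M, hM0, hM, hhM, him⟩ := exists_next_hole α.inv (h := h) (by omega)
  have bound : ∀ (γ : PartialInj n) (K : ℕ), (∀ t, 0 < t → t < K → h + t ∈ γ.dom) →
      ∀ u ∉ γ.dom, h < u → h + K ≤ u := by
    intro γ K hK u hu hlt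
    by_contra hc
    exact hu ((show u = h + (u - h) by omega) ▸ hK (u - h) (by omega) (by omega))
  by_cases hLe : L % 2 = 0
  · exact mem_generated_of_block hn hα hf (by omega) hhL hdom (Or.inl hLe) (next L hL0 hL)
  by_cases hMe : M % 2 = 0
  · exact of_inv (mem_generated_of_block hn (inv_mem_parityIF hα) hf.inv (by omega) hhM him
      (Or.inl hMe) (next M hM0 hM))
  by_cases hL1 : L = 1
  · by_cases hM1 : M = 1
    · subst hL1 hM1
      refine next 1 hL0 hL α hα ⟨hhL, hhM, fun x y hxy hlt => hf.2.2 x y hxy ?_⟩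
      have hx : x ≠ h := fun e => hf.1 ⟨y, e ▸ hxy⟩
      have hy : y ≠ h := fun e => hf.2.1 ⟨x, e ▸ hxy⟩
      omega
    · exact of_inv (mem_generated_of_block hn (inv_mem_parityIF hα) hf.inv (by omega) hhM him
        (Or.inr fun u hu hlt => ⟨h + L, hhL, by omega, bound α L hdom u hu hlt, by omega⟩)
        (next M hM0 hM))
  · exact mem_generated_of_block hn hα hf (by omega) hhL hdom
      (Or.inr fun u hu hlt => ⟨h + M, hhM, by omega, bound α.inv M him u hu hlt, by omega⟩)
      (next L hL0 hL)

theorem mem_generated_of_mem_parityIF (hn : Even n) (hα : α ∈ parityIF n) : α ∈ generated n := by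
  refine mem_generated_of_fixesBelow hn hα (h := 0) ⟨?_, ?_, fun x y _ h => by omega⟩
    (Nat.zero_le _) <;> rintro ⟨z, hz⟩ <;> have := bounds hz <;> omega

/-- A point whose parity is changed by `α` can be moved to the other parity class by a product of
generators defined on the whole domain of `α` and preserving the parity of its other points. -/
theorem exists_generated_change_parity (hn : Even n) (hα : α ∈ IFset n) (hxy : (x, y) ∈ α.graph)
    (hp : x % 2 ≠ y % 2) : ∃ τ ∈ generated n, ∀ z w, (z, w) ∈ α.graph →
      ∃ z', (z, z') ∈ τ.graph ∧ (z' % 2 = z % 2 ↔ z ≠ x) := by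
  have hn' := Nat.even_iff.1 hn
  have hb := bounds hxy
  have hiso : ∀ z w, (z, w) ∈ α.graph → x + 1 ≠ z ∧ z + 1 ≠ x := by
    intro z w hz
    have := mod_two_eq_of_adjacent hα hxy hz
    omega
  rcases Nat.mod_two_eq_zero_or_one x with hx | hx
  · refine ⟨rev n (x - 1) (n + 1) * (shift n).inv,
      mul_mem (rev_mem_generated hn (by omega) le_rfl (by omega))
        (inv_shift_mem_generated hn (by omega)), fun z w hz => ?_⟩
    have h1 := hiso z w hz
    have h2 := bounds hz
    have h3 := flip_eq (x - 1) (n + 1) z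
    simp only [mem_mul, mem_rev, mem_inv, mem_shift]
    exact ⟨if z = x then 1 else flip (x - 1) (n + 1) z + 2,
      ⟨flip (x - 1) (n + 1) z, by omega, by split_ifs <;> omega⟩, by split_ifs <;> omega⟩
  · refine ⟨rev n 0 (x + 1) * shift n,
      mul_mem (rev_mem_generated hn (by omega) (by omega) (by omega))
        (shift_mem_generated hn (by omega)), fun z w hz => ?_⟩
    have h1 := hiso z w hz
    have h2 := bounds hz
    have h3 := flip_eq 0 (x + 1) z
    simp only [mem_mul, mem_rev, mem_shift]
    exact ⟨if z = x then n else flip 0 (x + 1) z - 2,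
      ⟨flip 0 (x + 1) z, by omega, by split_ifs <;> omega⟩, by split_ifs <;> omega⟩

/-- The image points whose parity differs from that of their preimage. -/
def parityDefect (α : PartialInj n) : Set ℕ := {y | ∃ x, (x, y) ∈ α.graph ∧ x % 2 ≠ y % 2}

theorem parityDefect_finite (α : PartialInj n) : (parityDefect α).Finite :=
  (Set.finite_Iic n).subset fun _ ⟨_, hx, _⟩ => (bounds hx).2.2.2

theorem mem_generated_of_mem_IFset (hn : Even n) (hα : α ∈ IFset n) : α ∈ generated n := by
  induction hk : (parityDefect α).ncard using Nat.strong_induction_on generalizing α with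
  | _ k ih =>
  by_cases hpar : ∀ x y, (x, y) ∈ α.graph → x % 2 = y % 2
  · exact mem_generated_of_mem_parityIF hn ⟨hα, hpar⟩
  push Not at hpar
  obtain ⟨x, y, hxy, hp⟩ := hpar
  obtain ⟨τ, hτ, hmove⟩ := exists_generated_change_parity hn hα hxy hp
  have hsub : parityDefect (τ.inv * α) ⊂ parityDefect α := by
    rw [Set.ssubset_iff_of_subset]
    · refine ⟨y, ⟨x, hxy, hp⟩, ?_⟩
      rintro ⟨z, ⟨w, hw, hwy⟩, hz⟩
      obtain rfl := left_unique hwy hxy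
      obtain ⟨z', hz', h1⟩ := hmove w y hwy
      have := right_unique (mem_inv.1 hw) hz'
      omega
    · rintro v ⟨z, ⟨w, hw, hwv⟩, hz⟩
      obtain ⟨z', hz', h1⟩ := hmove w v hwv
      have h2 := right_unique (mem_inv.1 hw) hz'
      refine ⟨w, hwv, ?_⟩
      obtain rfl | hne := eq_or_ne w x
      · have := right_unique hwv hxy
        omega
      · omega
  have hlt := Set.ncard_lt_ncard hsub (parityDefect_finite α)
  have h1 := ih _ (hk ▸ hlt)
    (mul_mem_IFset (inv_mem_IFset (mem_IFset_of_mem_generated hn hτ)) hα) rfl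
  rw [← mul_inv_mul_cancel (α := α) (β := τ) fun z w hz => (hmove z w hz).imp fun _ h => h.1]
  exact mul_mem hτ h1

end Oriented

section Indecomposable

variable {n : ℕ} {α β γ : PartialInj n} {i u v L M : ℕ}

/-- `γ` cannot be written as a product of two elements of `IF_n` other than `γ`. -/
def Indecomposable (γ : PartialInj n) : Prop :=
  ∀ α ∈ IFset n, ∀ β ∈ IFset n, α * β = γ → α = γ ∨ β = γ

theorem Indecomposable.inv (h : Indecomposable γ) : Indecomposable γ.inv := by
  intro α hα β hβ e
  have := h β.inv (inv_mem_IFset hβ) α.inv (inv_mem_IFset hα) (by rw [← inv_mul, e]; rfl)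
  exact this.symm.imp (congrArg PartialInj.inv) (congrArg PartialInj.inv)

theorem Indecomposable.mem_of_mem_closure (h : Indecomposable γ) {A : Set (PartialInj n)}
    (hA : A ⊆ IFset n) (hγ : γ ∈ Subsemigroup.closure A) : γ ∈ A := by
  by_contra hc
  have key : ∀ α ∈ Subsemigroup.closure A, α ∈ IFset n ∧ α ≠ γ := by
    intro α hα
    induction hα using Subsemigroup.closure_induction with
    | mem x hx => exact ⟨hA hx, fun e => hc (e ▸ hx)⟩
    | mul x y _ _ hx hy =>
      exact ⟨mul_mem_IFset hx.1 hy.1, fun e => (h x hx.1 y hy.1 e).elim hx.2 hy.2⟩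
  exact (key γ hγ).2 rfl

theorem indecomposable_of_rigid
    (rigid : ∀ α ∈ IFset n, (∀ x y, (x, y) ∈ γ.graph → ∃ z, (x, z) ∈ α.graph) →
      (∀ x y, (x, y) ∈ γ.graph → (x, x) ∈ α.graph) ∨ γ.graph ⊆ α.graph)
    (maximal : ∀ α ∈ IFset n, γ.graph ⊆ α.graph → ∀ x y, (x, y) ∈ α.graph →
      ∃ z, (x, z) ∈ γ.graph) : Indecomposable γ := by
  have maximal' : ∀ α ∈ IFset n, γ.graph ⊆ α.graph → α = γ := by
    refine fun α hα hsub => PartialInj.ext_mem fun x y => ⟨fun hx => ?_, fun hx => hsub hx⟩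
    obtain ⟨z, hz⟩ := maximal α hα hsub x y hx
    exact right_unique (hsub hz) hx ▸ hz
  rintro α hα β hβ rfl
  rcases rigid α hα (fun x y ⟨z, hz, _⟩ => ⟨z, hz⟩) with h | h
  · refine Or.inr (maximal' β hβ fun ⟨x, y⟩ hxy => ?_)
    obtain ⟨z, hz, hzy⟩ := id hxy
    exact right_unique hz (h x y hxy) ▸ hzy
  · exact Or.inl (maximal' α hα h)

/-- Images of points on the two sides of a hole cannot interleave or touch. -/
theorem separated (hα : α ∈ IFset n) (hL : 2 ≤ L) (hM : 2 ≤ M)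
    (hu : ∀ t, 0 < t → t < L → ∃ x < i, (x, u + t) ∈ α.graph)
    (hv : ∀ t, 0 < t → t < M → ∃ x, i < x ∧ (x, v + t) ∈ α.graph) :
    u + L ≤ v ∨ v + M ≤ u := by
  by_contra hc
  have touch : ∀ s t, 0 < s → s < L → 0 < t → t < M →
      u + s = v + t ∨ u + s + 1 = v + t ∨ v + t + 1 = u + s → False := by
    intro s t hs hsL ht htM h
    obtain ⟨x, hx, hxs⟩ := hu s hs hsL
    obtain ⟨y, hy, hyt⟩ := hv t ht htM
    rcases h with h | h
    · have := left_unique hxs (h ▸ hyt)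
      omega
    · have := (adjacent_iff hα hxs hyt).2 h
      omega
  rcases lt_trichotomy u v with h | h | h
  · exact touch (v - u) 1 (by omega) (by omega) (by omega) (by omega) (by omega)
  · exact touch 1 1 (by omega) (by omega) (by omega) (by omega) (by omega)
  · exact touch 1 (u - v) (by omega) (by omega) (by omega) (by omega) (by omega)

/-- A refinement of `image_of_run` recording bounds and, for at least two points, parities. -/
theorem image_of_run_bounded {h : ℕ} (hα : α ∈ IFset n) (hL : 2 ≤ L)
    (hdom : ∀ t, 0 < t → t < L → ∃ y, (h + t, y) ∈ α.graph) :
    ∃ u, u + L ≤ n + 1 ∧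
      (∀ t, 0 < t → t < L → ∃ s, 0 < s ∧ s < L ∧ (h + s, u + t) ∈ α.graph) ∧
      ((∀ t, 0 < t → t < L → (h + t, u + t) ∈ α.graph) ∧ (3 ≤ L → h % 2 = u % 2) ∨
      (∀ t, 0 < t → t < L → (h + t, u + L - t) ∈ α.graph) ∧
        (3 ≤ L → h % 2 = (u + L) % 2)) := by
  obtain ⟨u, hu | hu⟩ := image_of_run hα hL hdom
  · refine ⟨u, ?_, fun t h0 ht => ⟨t, h0, ht, hu t h0 ht⟩, Or.inl ⟨hu, fun hL3 => ?_⟩⟩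
    · have := bounds (hu (L - 1) (by omega) (by omega))
      omega
    · have := mod_two_eq_of_adjacent hα (hu 1 (by omega) (by omega)) (hu 2 (by omega) (by omega))
        (by omega)
      omega
  · refine ⟨u, ?_, fun t h0 ht => ⟨L - t, by omega, by omega, ?_⟩, Or.inr ⟨hu, fun hL3 => ?_⟩⟩
    · have := bounds (hu 1 (by omega) (by omega))
      omega
    · have := hu (L - t) (by omega) (by omega)
      rwa [show u + L - (L - t) = u + t by omega] at this
    · have := mod_two_eq_of_adjacent hα (hu 1 (by omega) (by omega)) (hu 2 (by omega) (by omega))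
        (by omega)
      omega

theorem indecomposable_one (hn : Even n) (hn0 : 0 < n) : Indecomposable (1 : PartialInj n) := by
  have hn' := Nat.even_iff.1 hn
  refine indecomposable_of_rigid (fun α hα hdom => Or.inl fun x y hxy => ?_)
    fun α hα _ x y hxy => ⟨x, ?_⟩
  · rw [mem_one] at hxy
    obtain ⟨u, hb, -, ⟨hu, hp⟩ | ⟨hu, hp⟩⟩ := image_of_run_bounded (h := 0) (L := n + 1) hα
      (by omega) fun t h0 ht => hdom _ (0 + t) (mem_one.2 (by omega))
    · have := hu x (by omega) (by omega)
      rwa [Nat.zero_add, show u + x = x by omega] at this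
    · omega
  · have := bounds hxy
    rw [mem_one]
    omega

theorem indecomposable_rev_zero (hn : Even n) (hi : i % 2 = 0) (hi4 : 4 ≤ i) (hin : i ≤ n) :
    Indecomposable (rev n 0 i) := by
  have hn' := Nat.even_iff.1 hn
  refine indecomposable_of_rigid (fun α hα hdom => ?_) fun α hα hsub x y hxy => ?_
  · have hdom' : ∀ x, 0 < x → x ≤ n → x ≠ i → ∃ z, (x, z) ∈ α.graph := fun x h0 hx hxi =>
      hdom x (flip 0 i x) (by
        have := flip_eq 0 i x
        rw [mem_rev]
        omega)
    obtain ⟨u, hb, hrange, hu⟩ := image_of_run_bounded (h := 0) (L := i) hα (by omega)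
      fun t h0 ht => hdom' (0 + t) (by omega) (by omega) (by omega)
    simp only [Nat.zero_add] at hrange hu
    have main : u = 0 ∧ ∀ x, i < x → x ≤ n → (x, x) ∈ α.graph := by
      obtain rfl | hlt := hin.eq_or_lt
      · exact ⟨by omega, fun x h1 h2 => by omega⟩
      obtain ⟨v, hb', hrange', hv⟩ := image_of_run_bounded (h := i) (L := n + 1 - i) hα
        (by omega) fun t h0 ht => hdom' (i + t) (by omega) (by omega) (by omega)
      have hsep := separated (i := i) hα (by omega) (by omega)
        (fun t h0 ht => (hrange t h0 ht).imp fun s hs => ⟨hs.2.1, hs.2.2⟩)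
        (fun t h0 ht => (hrange' t h0 ht).elim fun s hs => ⟨i + s, by omega, hs.2.2⟩)
      refine ⟨by omega, fun x h1 h2 => ?_⟩
      rcases hv with hv | hv
      · have := hv.1 (x - i) (by omega) (by omega)
        rwa [show i + (x - i) = x by omega, show v + (x - i) = x by omega] at this
      · omega
    obtain ⟨rfl, hfix⟩ := main
    simp only [Nat.zero_add] at hu
    rcases hu with hu | hu
    · refine Or.inl fun x y hxy => ?_
      rw [mem_rev] at hxy
      by_cases hx : x < i
      · exact hu.1 x (by omega) hx
      · exact hfix x (by omega) (by omega)
    · refine Or.inr fun ⟨x, y⟩ hxy => ?_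
      rw [mem_rev] at hxy
      have hf := flip_eq 0 i x
      by_cases hx : x < i
      · rw [show y = i - x by omega]
        exact hu.1 x (by omega) hx
      · rw [show y = x by omega]
        exact hfix x (by omega) (by omega)
  · have hb := bounds hxy
    have hf := flip_eq 0 i x
    have h1 : (i - 1, 1) ∈ α.graph := hsub (mem_rev.2 (by have := flip_eq 0 i (i - 1); omega))
    have h2 : (i - 2, 2) ∈ α.graph := hsub (mem_rev.2 (by have := flip_eq 0 i (i - 2); omega))
    refine ⟨flip 0 i x, mem_rev.2 ⟨by omega, by omega, ?_, rfl⟩⟩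
    rintro rfl
    have h3 := (adjacent_iff hα h1 hxy).1 (by omega)
    have h4 := left_unique hxy ((show y = 2 by omega) ▸ h2)
    omega

theorem indecomposable_rev_last (hn : Even n) (hi : i % 2 = 1) (hin : i + 3 ≤ n) :
    Indecomposable (rev n i (n + 1)) := by
  have hn' := Nat.even_iff.1 hn
  refine indecomposable_of_rigid (fun α hα hdom => ?_) fun α hα hsub x y hxy => ?_
  · have hdom' : ∀ x, 0 < x → x ≤ n → x ≠ i → ∃ z, (x, z) ∈ α.graph := fun x h0 hx hxi =>
      hdom x (flip i (n + 1) x) (by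
        have := flip_eq i (n + 1) x
        rw [mem_rev]
        omega)
    obtain ⟨v, hb, hrange, hv⟩ := image_of_run_bounded (h := i) (L := n + 1 - i) hα
      (by omega) fun t h0 ht => hdom' (i + t) (by omega) (by omega) (by omega)
    have main : v = i ∧ ∀ x, 0 < x → x < i → (x, x) ∈ α.graph := by
      by_cases hi1 : i = 1
      · exact ⟨by omega, fun x h1 h2 => by omega⟩
      obtain ⟨u, hb', hrange', hu⟩ := image_of_run_bounded (h := 0) (L := i) hα (by omega)
        fun t h0 ht => hdom' (0 + t) (by omega) (by omega) (by omega)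
      simp only [Nat.zero_add] at hrange' hu
      have hsep := separated (i := i) hα (by omega) (by omega)
        (fun t h0 ht => (hrange' t h0 ht).imp fun s hs => ⟨hs.2.1, hs.2.2⟩)
        (fun t h0 ht => (hrange t h0 ht).elim fun s hs => ⟨i + s, by omega, hs.2.2⟩)
      refine ⟨by omega, fun x h1 h2 => ?_⟩
      rcases hu with hu | hu
      · have := hu.1 x h1 h2
        rwa [show u + x = x by omega] at this
      · omega
    obtain ⟨rfl, hfix⟩ := main
    rcases hv with hv | hv
    · refine Or.inl fun x y hxy => ?_
      rw [mem_rev] at hxy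
      by_cases hx : x < v
      · exact hfix x (by omega) hx
      · have := hv.1 (x - v) (by omega) (by omega)
        rwa [show v + (x - v) = x by omega] at this
    · refine Or.inr fun ⟨x, y⟩ hxy => ?_
      rw [mem_rev] at hxy
      have hf := flip_eq v (n + 1) x
      by_cases hx : x < v
      · rw [show y = x by omega]
        exact hfix x (by omega) hx
      · have := hv.1 (x - v) (by omega) (by omega)
        rwa [show v + (x - v) = x by omega,
          show v + (n + 1 - v) - (x - v) = y by omega] at this
  · have hb := bounds hxy
    have hf := flip_eq i (n + 1) x
    have h1 : (i + 1, n) ∈ α.graph :=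
      hsub (mem_rev.2 (by have := flip_eq i (n + 1) (i + 1); omega))
    have h2 : (i + 2, n - 1) ∈ α.graph :=
      hsub (mem_rev.2 (by have := flip_eq i (n + 1) (i + 2); omega))
    refine ⟨flip i (n + 1) x, mem_rev.2 ⟨by omega, ?_, by omega, rfl⟩⟩
    rintro rfl
    have h3 := (adjacent_iff hα h1 hxy).1 (by omega)
    have h4 := left_unique hxy ((show y = n - 1 by omega) ▸ h2)
    omega

theorem indecomposable_shift (hn : Even n) (hn0 : 0 < n) : Indecomposable (shift n) := by
  have hn' := Nat.even_iff.1 hn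
  refine indecomposable_of_rigid (fun α hα hdom => ?_) fun α hα hsub x y hxy => ?_
  · obtain ⟨w, hw⟩ := hdom 1 n (mem_shift.2 (by omega))
    have hwb := bounds hw
    have main : (w = 1 ∧ ∀ x, 3 ≤ x → x ≤ n → (x, x) ∈ α.graph) ∨
        (w = n ∧ ∀ x, 3 ≤ x → x ≤ n → (x, x - 2) ∈ α.graph) := by
      by_cases hn2 : n = 2
      · by_cases hw1 : w = 1
        · exact Or.inl ⟨hw1, fun x h1 h2 => by omega⟩
        · exact Or.inr ⟨by omega, fun x h1 h2 => by omega⟩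
      obtain ⟨v, hb, hrange, hv⟩ := image_of_run_bounded (h := 2) (L := n - 1) hα
        (by omega) fun t h0 ht => hdom (2 + t) t (mem_shift.2 (by omega))
      have hsep := separated (i := 2) (u := w - 1) (L := 2) hα le_rfl (by omega)
        (fun t h0 ht => ⟨1, by omega, (show w = w - 1 + t by omega) ▸ hw⟩)
        (fun t h0 ht => (hrange t h0 ht).elim fun s hs => ⟨2 + s, by omega, hs.2.2⟩)
      rcases hv with hv | hv
      · obtain rfl | rfl : v = 0 ∨ v = 2 := by omega
        · refine Or.inr ⟨by omega, fun x h1 h2 => ?_⟩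
          have := hv.1 (x - 2) (by omega) (by omega)
          rwa [show 2 + (x - 2) = x by omega, Nat.zero_add] at this
        · refine Or.inl ⟨by omega, fun x h1 h2 => ?_⟩
          have := hv.1 (x - 2) (by omega) (by omega)
          rwa [show 2 + (x - 2) = x by omega] at this
      · omega
    rcases main with ⟨rfl, h⟩ | ⟨rfl, h⟩
    · refine Or.inl fun x y hxy => ?_
      rw [mem_shift] at hxy
      by_cases hx : x = 1
      · exact hx ▸ hw
      · exact h x (by omega) (by omega)
    · refine Or.inr fun ⟨x, y⟩ hxy => ?_
      rw [mem_shift] at hxy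
      by_cases hx : x = 1
      · rw [hx, show y = w by omega]
        exact hw
      · rw [show y = x - 2 by omega]
        exact h x (by omega) (by omega)
  · have hb := bounds hxy
    have h1 : (1, n) ∈ α.graph := hsub (mem_shift.2 (by omega))
    have hx : x ≠ 2 := by
      rintro rfl
      have h2 := (adjacent_iff hα h1 hxy).1 (by omega)
      have h3 := mod_two_eq_of_adjacent hα hxy h1 (by omega)
      omega
    by_cases hx1 : x = 1
    · exact ⟨n, mem_shift.2 (by omega)⟩
    · exact ⟨x - 2, mem_shift.2 (by omega)⟩

theorem indecomposable_generator (hn : Even n) (hn0 : 0 < n) (hi : i ≤ n) :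
    Indecomposable (generator n i) := by
  rcases generator_cases hn hi with ⟨_, h⟩ | ⟨_, h⟩ | ⟨_, h⟩ | ⟨hi, h4, h⟩ | ⟨hi, h3, h⟩ <;> rw [h]
  · exact indecomposable_one hn hn0
  · exact indecomposable_shift hn hn0
  · exact (indecomposable_shift hn hn0).inv
  · exact indecomposable_rev_zero hn hi h4 (by assumption)
  · exact indecomposable_rev_last hn hi h3

end Indecomposable

/-- Theorem: for even `n`, the rank of `IF_n` is `n + 1`. -/
theorem rank_IFn (n : ℕ) (hn : Even n) (hn0 : 0 < n) :
    IsLeast {k : ℕ | ∃ A : Finset (PartialInj n), ↑A ⊆ IFset n ∧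
      ↑(Subsemigroup.closure (A : Set (PartialInj n))) = IFset n ∧ A.card = k}
      (n + 1) := by
  classical
  have hcard : ((Finset.Iic n).image (generator n)).card = n + 1 := by
    rw [Finset.card_image_of_injOn (by simpa using generator_injOn hn), Nat.card_Iic]
  constructor
  · refine ⟨(Finset.Iic n).image (generator n), ?_, ?_, hcard⟩
    · intro α hα
      obtain ⟨i, hi, rfl⟩ := Finset.mem_image.1 hα
      exact generator_mem_IFset hn (Finset.mem_Iic.1 hi)
    · rw [Finset.coe_image, Finset.coe_Iic]
      exact Set.Subset.antisymm (fun _ => mem_IFset_of_mem_generated hn)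
        fun _ => mem_generated_of_mem_IFset hn
  · rintro k ⟨A, hA, hcl, rfl⟩
    rw [← hcard]
    refine Finset.card_le_card fun α hα => ?_
    obtain ⟨i, hi, rfl⟩ := Finset.mem_image.1 hα
    have hi' := Finset.mem_Iic.1 hi
    refine (indecomposable_generator hn hn0 hi').mem_of_mem_closure hA ?_
    rw [← SetLike.mem_coe, hcl]
    exact generator_mem_IFset hn hi'

end FencePaper
end

section
/- Every regular element of PFI_n belongs to IF_n: if α ∈ PFI_n and there exists β ∈ PFI_n with αβα = α, then α⁻¹ ∈ PFI_n, i.e. α ∈ IF_n. -/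
/-!
Common framework: partial injections on `X_n = {1, …, n}`, the fence order,
fence-preserving partial injections, the semigroups `PFI_n`, `IF_n`,
the set `J` of elements of rank at least `n - 2`, and (for even `n`)
the generating system `G`.
-/

namespace FencePaper

open PartialInj

/-- If `αβα = α` then `β` extends the inverse of `α`. -/
theorem swap_mem_graph_of_mul_mul_eq {n : ℕ} {α β : PartialInj n} (h : α * β * α = α)
    {x y : ℕ} (hxy : (x, y) ∈ α.graph) : (y, x) ∈ β.graph := by
  have hxy' := hxy
  rw [← h] at hxy'
  obtain ⟨z, ⟨w, hxw, hwz⟩, hzy⟩ := hxy'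
  obtain rfl : z = x := α.injOn (z, y) hzy (x, y) hxy rfl
  obtain rfl : w = y := α.functional (z, w) hxw (z, y) hxy rfl
  exact hwz

/-- Every regular element of `PFI_n` belongs to `IF_n`. -/
theorem regular_mem_IF (n : ℕ) (α β : PartialInj n)
    (hα : α ∈ PFIset n) (hβ : β ∈ PFIset n) (hreg : α * β * α = α) :
    α.inv ∈ PFIset n ∧ α ∈ IFset n := by
  have hinv : α.inv.FP := fun p hp q hq hpq =>
    hβ p (swap_mem_graph_of_mul_mul_eq hreg hp) q (swap_mem_graph_of_mul_mul_eq hreg hq) hpq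
  exact ⟨hinv, hα, hinv⟩

end FencePaper
end

section
/- Let n be even with n ≥ 4. For i ∈ X_n let ε_i = id|_{X_n ∖ {i}} (the identity map restricted to X_n ∖ {i}). Then ε₂ = σ₁σ₂, ε_{n−1} = σ₂σ₁, ε_i = γ_iγ_i for every even i with 4 ≤ i ≤ n, and ε_i = δ_iδ_i for every odd i with 1 ≤ i ≤ n − 3. Consequently, ε_i ∈ ⟨G⟩ for every i ∈ X_n. -/
/-!
Common framework: partial injections on `X_n = {1, …, n}`, the fence order,
fence-preserving partial injections, the semigroups `PFI_n`, `IF_n`,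
the set `J` of elements of rank at least `n - 2`, and (for even `n`)
the generating system `G`.
-/

namespace FencePaper

open PartialInj

/-- If `α` is defined exactly on `X_n ∖ {i}` and `β` undoes `α` there, then `ε_i = α β`. -/
theorem pid_diff_singleton_eq_mul {n i : ℕ} {α β : PartialInj n} (hi : ∀ y, (i, y) ∉ α.graph)
    (h : ∀ x, 1 ≤ x → x ≤ n → x ≠ i → ∃ y, (x, y) ∈ α.graph ∧ (y, x) ∈ β.graph) :
    pid n (Set.Icc 1 n \ {i}) = α * β := by
  apply ext'
  ext ⟨x, z⟩
  constructor
  · rintro ⟨-, ⟨⟨hx1, hxn⟩, hxi⟩, hzx⟩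
    obtain rfl : z = x := hzx
    exact h z hx1 hxn hxi
  · rintro ⟨y, hxy, hyz⟩
    obtain ⟨hx1, hxn, -, -⟩ := α.mem_le _ hxy
    have hxi : x ≠ i := fun hxi => hi y (hxi ▸ hxy)
    obtain ⟨w, hxw, hwx⟩ := h x hx1 hxn hxi
    obtain rfl : y = w := α.functional _ hxy _ hxw rfl
    exact ⟨⟨hx1, hxn⟩, ⟨⟨hx1, hxn⟩, hxi⟩, β.functional _ hyz _ hwx rfl⟩

/-- The partial identities `ε_i = id|_{X_n ∖ {i}}` factor through `G`. -/
theorem eps_in_G (n : ℕ) (hn : Even n) (hn4 : 4 ≤ n)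
    (σ₁ σ₂ : PartialInj n) (γ δ : ℕ → PartialInj n)
    (hσ₁ : σ₁.graph = sigma1Graph n) (hσ₂ : σ₂.graph = sigma2Graph n)
    (hγ : ∀ i, Even i → 4 ≤ i → i ≤ n → (γ i).graph = gammaGraph n i)
    (hδ : ∀ i, Odd i → i ≤ n - 3 → (δ i).graph = deltaGraph n i) :
    pid n (Set.Icc 1 n \ {2}) = σ₁ * σ₂ ∧
    pid n (Set.Icc 1 n \ {n - 1}) = σ₂ * σ₁ ∧
    (∀ i, Even i → 4 ≤ i → i ≤ n → pid n (Set.Icc 1 n \ {i}) = γ i * γ i) ∧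
    (∀ i, Odd i → i ≤ n - 3 → pid n (Set.Icc 1 n \ {i}) = δ i * δ i) ∧
    (∀ i ∈ Set.Icc 1 n,
      pid n (Set.Icc 1 n \ {i}) ∈ Subsemigroup.closure (Gset n σ₁ σ₂ γ δ)) := by
  have hε₂ : pid n (Set.Icc 1 n \ {2}) = σ₁ * σ₂ := by
    refine pid_diff_singleton_eq_mul (by simp [hσ₁, sigma1Graph]) fun x hx1 hxn hx => ?_
    refine ⟨if x = 1 then n else x - 2, ?_⟩
    simp only [hσ₁, hσ₂, sigma1Graph, sigma2Graph, Set.mem_ofPred_eq]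
    grind
  have hεn : pid n (Set.Icc 1 n \ {n - 1}) = σ₂ * σ₁ := by
    refine pid_diff_singleton_eq_mul (by simp [hσ₂, sigma2Graph]) fun x hx1 hxn hx => ?_
    refine ⟨if x = n then 1 else x + 2, ?_⟩
    simp only [hσ₁, hσ₂, sigma1Graph, sigma2Graph, Set.mem_ofPred_eq]
    grind
  have hεγ : ∀ i, Even i → 4 ≤ i → i ≤ n → pid n (Set.Icc 1 n \ {i}) = γ i * γ i := by
    intro i hi hi4 hin
    have hg := hγ i hi hi4 hin
    refine pid_diff_singleton_eq_mul (by simp [hg, gammaGraph]) fun x hx1 hxn hx => ?_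
    refine ⟨if x < i then i - x else x, ?_⟩
    simp only [hg, gammaGraph, Set.mem_ofPred_eq]
    grind
  have hεδ : ∀ i, Odd i → i ≤ n - 3 → pid n (Set.Icc 1 n \ {i}) = δ i * δ i := by
    intro i hi hin
    have hd := hδ i hi hin
    refine pid_diff_singleton_eq_mul (by simp [hd, deltaGraph]) fun x hx1 hxn hx => ?_
    refine ⟨if x < i then x else n + i + 1 - x, ?_⟩
    simp only [hd, deltaGraph, Set.mem_ofPred_eq]
    grind
  refine ⟨hε₂, hεn, hεγ, hεδ, ?_⟩
  rintro i ⟨hi1, hin⟩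
  have mul_mem_closure {a b : PartialInj n} (ha : a ∈ Gset n σ₁ σ₂ γ δ)
      (hb : b ∈ Gset n σ₁ σ₂ γ δ) : a * b ∈ Subsemigroup.closure (Gset n σ₁ σ₂ γ δ) :=
    mul_mem (Subsemigroup.subset_closure ha) (Subsemigroup.subset_closure hb)
  have hσ₁G : σ₁ ∈ Gset n σ₁ σ₂ γ δ := by simp [Gset]
  have hσ₂G : σ₂ ∈ Gset n σ₁ σ₂ γ δ := by simp [Gset]
  rcases Nat.even_or_odd i with hi | hi
  · by_cases hi4 : 4 ≤ i
    · have hG : γ i ∈ Gset n σ₁ σ₂ γ δ := Or.inl (Or.inr ⟨i, hi, hi4, hin, rfl⟩)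
      exact hεγ i hi hi4 hin ▸ mul_mem_closure hG hG
    · obtain rfl : i = 2 := by grind
      exact hε₂ ▸ mul_mem_closure hσ₁G hσ₂G
  · by_cases hi3 : i ≤ n - 3
    · have hG : δ i ∈ Gset n σ₁ σ₂ γ δ := Or.inr ⟨i, hi, hi3, rfl⟩
      exact hεδ i hi hi3 ▸ mul_mem_closure hG hG
    · obtain rfl : i = n - 1 := by grind
      exact hεn ▸ mul_mem_closure hσ₂G hσ₁G

end FencePaper
end

section
/- Let n be even. For 1 ≤ i < j ≤ n with i ≡ j (mod 2), let β_{i,j} be the partial injection of X_n with dom β_{i,j} = X_n ∖ {i, j}, where xβ_{i,j} = x for x < i and for x > j, and xβ_{i,j} = i + j − x for i < x < j. Then β_{i,j} ∈ ⟨G⟩; moreover, if i and j are both odd and j − i ≥ 4 then β_{i,j} = δ_i δ_{n−j+i+1} δ_i, and if i and j are both even and j − i ≥ 4 then β_{i,j} = γ_j γ_{j−i} γ_j. -/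
/-!
Common framework: partial injections on `X_n = {1, …, n}`, the fence order,
fence-preserving partial injections, the semigroups `PFI_n`, `IF_n`,
the set `J` of elements of rank at least `n - 2`, and (for even `n`)
the generating system `G`.
-/

namespace FencePaper

open PartialInj

section Auxiliary

variable {n : ℕ}

theorem mem_mul_graph (α β : PartialInj n) (x z : ℕ) :
    (x, z) ∈ (α * β).graph ↔ ∃ y, (x, y) ∈ α.graph ∧ (y, z) ∈ β.graph := Iff.rfl

/-- The graph of the idempotent with domain `X_n ∖ {i}`. -/
def puncturedIdGraph (n i : ℕ) : Set (ℕ × ℕ) :=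
  {q | 1 ≤ q.1 ∧ q.1 ≤ n ∧ q.1 ≠ i ∧ q.2 = q.1}

theorem sigma1_mul_sigma2_graph (hn : Even n) {σ₁ σ₂ : PartialInj n}
    (h₁ : σ₁.graph = sigma1Graph n) (h₂ : σ₂.graph = sigma2Graph n) :
    (σ₁ * σ₂).graph = puncturedIdGraph n 2 := by
  obtain ⟨m, rfl⟩ := hn
  ext ⟨x, z⟩
  simp only [mem_mul_graph, h₁, h₂, sigma1Graph, sigma2Graph, puncturedIdGraph, Set.mem_ofPred_eq]
  constructor
  · rintro ⟨y, h, h'⟩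
    split_ifs at h h' <;> omega
  · intro h
    refine ⟨if x = 1 then m + m else x - 2, ?_, ?_⟩ <;> split_ifs <;> omega

theorem sigma2_mul_sigma1_graph (hn : Even n) {σ₁ σ₂ : PartialInj n}
    (h₁ : σ₁.graph = sigma1Graph n) (h₂ : σ₂.graph = sigma2Graph n) :
    (σ₂ * σ₁).graph = puncturedIdGraph n (n - 1) := by
  obtain ⟨m, rfl⟩ := hn
  ext ⟨x, z⟩
  simp only [mem_mul_graph, h₁, h₂, sigma1Graph, sigma2Graph, puncturedIdGraph, Set.mem_ofPred_eq]
  constructor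
  · rintro ⟨y, h, h'⟩
    split_ifs at h h' <;> omega
  · intro h
    refine ⟨if x = m + m then 1 else x + 2, ?_, ?_⟩ <;> split_ifs <;> omega

theorem gamma_mul_self_graph {i : ℕ} (hi : i ≤ n) {g : PartialInj n}
    (hg : g.graph = gammaGraph n i) : (g * g).graph = puncturedIdGraph n i := by
  ext ⟨x, z⟩
  simp only [mem_mul_graph, hg, gammaGraph, puncturedIdGraph, Set.mem_ofPred_eq]
  constructor
  · rintro ⟨y, h, h'⟩
    split_ifs at h h' <;> omega
  · intro h
    refine ⟨if x < i then i - x else x, ?_, ?_⟩ <;> split_ifs <;> omega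

theorem delta_mul_self_graph {i : ℕ} {d : PartialInj n}
    (hd : d.graph = deltaGraph n i) : (d * d).graph = puncturedIdGraph n i := by
  ext ⟨x, z⟩
  simp only [mem_mul_graph, hd, deltaGraph, puncturedIdGraph, Set.mem_ofPred_eq]
  constructor
  · rintro ⟨y, h, h'⟩
    split_ifs at h h' <;> omega
  · intro h
    refine ⟨if x < i then x else n + i + 1 - x, ?_, ?_⟩ <;> split_ifs <;> omega

theorem mul_graph_eq_beta_add_two {i : ℕ} {a b : PartialInj n}
    (ha : a.graph = puncturedIdGraph n i) (hb : b.graph = puncturedIdGraph n (i + 2)) :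
    (a * b).graph = betaGraph n i (i + 2) := by
  ext ⟨x, z⟩
  simp only [mem_mul_graph, ha, hb, puncturedIdGraph, betaGraph, Set.mem_ofPred_eq]
  constructor
  · rintro ⟨y, h, h'⟩
    split_ifs <;> omega
  · intro h
    refine ⟨x, ?_, ?_⟩ <;> split_ifs at h <;> omega

theorem delta_conj_graph {i j : ℕ} (hij : i < j) (hj : j ≤ n) {d e : PartialInj n}
    (hd : d.graph = deltaGraph n i) (he : e.graph = deltaGraph n (n - j + i + 1)) :
    (d * e * d).graph = betaGraph n i j := by
  ext ⟨x, z⟩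
  simp only [mem_mul_graph, hd, he, deltaGraph, betaGraph, Set.mem_ofPred_eq]
  constructor
  · rintro ⟨w, ⟨y, h, h'⟩, h''⟩
    split_ifs at h h' h'' ⊢ <;> omega
  · intro h
    refine ⟨if x < i then x else if x < j then n - j + 1 + x else n + i + 1 - x,
      ⟨if x < i then x else n + i + 1 - x, ?_, ?_⟩, ?_⟩ <;> split_ifs at h ⊢ <;> omega

theorem gamma_conj_graph {i j : ℕ} (hij : i < j) (hj : j ≤ n) {c e : PartialInj n}
    (hc : c.graph = gammaGraph n j) (he : e.graph = gammaGraph n (j - i)) :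
    (c * e * c).graph = betaGraph n i j := by
  ext ⟨x, z⟩
  simp only [mem_mul_graph, hc, he, gammaGraph, betaGraph, Set.mem_ofPred_eq]
  constructor
  · rintro ⟨w, ⟨y, h, h'⟩, h''⟩
    split_ifs at h h' h'' ⊢ <;> omega
  · intro h
    refine ⟨if j < x then x else if i < x then x - i else j - x,
      ⟨if x < j then j - x else x, ?_, ?_⟩, ?_⟩ <;> split_ifs at h ⊢ <;> omega

section Generators

variable {σ₁ σ₂ : PartialInj n} {γ δ : ℕ → PartialInj n}

theorem gamma_mem_closure {i : ℕ} (hi : Even i) (h4 : 4 ≤ i) (hin : i ≤ n) :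
    γ i ∈ Subsemigroup.closure (Gset n σ₁ σ₂ γ δ) :=
  Subsemigroup.subset_closure (Or.inl (Or.inr ⟨i, hi, h4, hin, rfl⟩))

theorem delta_mem_closure {i : ℕ} (hi : Odd i) (hin : i ≤ n - 3) :
    δ i ∈ Subsemigroup.closure (Gset n σ₁ σ₂ γ δ) :=
  Subsemigroup.subset_closure (Or.inr ⟨i, hi, hin, rfl⟩)

theorem exists_mem_closure_graph_eq_puncturedId (hn : Even n)
    (hσ₁ : σ₁.graph = sigma1Graph n) (hσ₂ : σ₂.graph = sigma2Graph n)
    (hγ : ∀ i, Even i → 4 ≤ i → i ≤ n → (γ i).graph = gammaGraph n i)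
    (hδ : ∀ i, Odd i → i ≤ n - 3 → (δ i).graph = deltaGraph n i)
    {i : ℕ} (h1 : 1 ≤ i) (hin : i ≤ n) :
    ∃ a ∈ Subsemigroup.closure (Gset n σ₁ σ₂ γ δ), a.graph = puncturedIdGraph n i := by
  have m₁ : σ₁ ∈ Subsemigroup.closure (Gset n σ₁ σ₂ γ δ) :=
    Subsemigroup.subset_closure (by simp [Gset])
  have m₂ : σ₂ ∈ Subsemigroup.closure (Gset n σ₁ σ₂ γ δ) :=
    Subsemigroup.subset_closure (by simp [Gset])
  rcases Nat.even_or_odd i with hi | hi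
  · by_cases h4 : 4 ≤ i
    · have m := gamma_mem_closure (σ₁ := σ₁) (σ₂ := σ₂) (γ := γ) (δ := δ) hi h4 hin
      exact ⟨_, mul_mem m m, gamma_mul_self_graph hin (hγ i hi h4 hin)⟩
    · obtain rfl : i = 2 := by grind
      exact ⟨_, mul_mem m₁ m₂, sigma1_mul_sigma2_graph hn hσ₁ hσ₂⟩
  · by_cases h3 : i ≤ n - 3
    · have m := delta_mem_closure (σ₁ := σ₁) (σ₂ := σ₂) (γ := γ) (δ := δ) hi h3
      exact ⟨_, mul_mem m m, delta_mul_self_graph (hδ i hi h3)⟩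
    · obtain rfl : i = n - 1 := by grind
      exact ⟨_, mul_mem m₂ m₁, sigma2_mul_sigma1_graph hn hσ₁ hσ₂⟩

end Generators

end Auxiliary

/-- The maps `β_{i,j}` lie in `⟨G⟩`, with the explicit factorizations. -/
theorem beta_in_G (n : ℕ) (hn : Even n) (hn0 : 0 < n)
    (σ₁ σ₂ : PartialInj n) (γ δ : ℕ → PartialInj n)
    (hσ₁ : σ₁.graph = sigma1Graph n) (hσ₂ : σ₂.graph = sigma2Graph n)
    (hγ : ∀ i, Even i → 4 ≤ i → i ≤ n → (γ i).graph = gammaGraph n i)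
    (hδ : ∀ i, Odd i → i ≤ n - 3 → (δ i).graph = deltaGraph n i)
    (B : ℕ → ℕ → PartialInj n)
    (hB : ∀ i j, 1 ≤ i → i < j → j ≤ n → i % 2 = j % 2 →
      (B i j).graph = betaGraph n i j) :
    ∀ i j, 1 ≤ i → i < j → j ≤ n → i % 2 = j % 2 →
      B i j ∈ Subsemigroup.closure (Gset n σ₁ σ₂ γ δ) ∧
      (Odd i → Odd j → i + 4 ≤ j → B i j = δ i * δ (n - j + i + 1) * δ i) ∧
      (Even i → Even j → i + 4 ≤ j → B i j = γ j * γ (j - i) * γ j) := by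
  intro i j h1 hij hjn hmod
  have hodd : Odd i → Odd j → i + 4 ≤ j →
      Odd (n - j + i + 1) ∧ i ≤ n - 3 ∧ n - j + i + 1 ≤ n - 3 := by grind
  have heven : Even i → Even j → i + 4 ≤ j →
      Even (j - i) ∧ 4 ≤ j ∧ 4 ≤ j - i ∧ j - i ≤ n := by grind
  have hδδ : Odd i → Odd j → i + 4 ≤ j → B i j = δ i * δ (n - j + i + 1) * δ i := by
    intro hi hj h4
    obtain ⟨hk, hin, hkn⟩ := hodd hi hj h4
    exact ext' ((hB i j h1 hij hjn hmod).trans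
      (delta_conj_graph hij hjn (hδ i hi hin) (hδ _ hk hkn)).symm)
  have hγγ : Even i → Even j → i + 4 ≤ j → B i j = γ j * γ (j - i) * γ j := by
    intro hi hj h4
    obtain ⟨hk, hj4, hk4, hkn⟩ := heven hi hj h4
    exact ext' ((hB i j h1 hij hjn hmod).trans
      (gamma_conj_graph hij hjn (hγ j hj hj4 hjn) (hγ _ hk hk4 hkn)).symm)
  refine ⟨?_, hδδ, hγγ⟩
  by_cases h4 : i + 4 ≤ j
  · rcases Nat.even_or_odd i with hi | hi
    · have hj : Even j := by grind
      obtain ⟨hk, hj4, hk4, hkn⟩ := heven hi hj h4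
      rw [hγγ hi hj h4]
      exact mul_mem (mul_mem (gamma_mem_closure hj hj4 hjn) (gamma_mem_closure hk hk4 hkn))
        (gamma_mem_closure hj hj4 hjn)
    · have hj : Odd j := by grind
      obtain ⟨hk, hin, hkn⟩ := hodd hi hj h4
      rw [hδδ hi hj h4]
      exact mul_mem (mul_mem (delta_mem_closure hi hin) (delta_mem_closure hk hkn))
        (delta_mem_closure hi hin)
  · obtain rfl : j = i + 2 := by omega
    obtain ⟨a, ha, hag⟩ :=
      exists_mem_closure_graph_eq_puncturedId hn hσ₁ hσ₂ hγ hδ h1 (by omega)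
    obtain ⟨b, hb, hbg⟩ :=
      exists_mem_closure_graph_eq_puncturedId hn hσ₁ hσ₂ hγ hδ (by omega) hjn
    have hab : B i (i + 2) = a * b :=
      ext' ((hB _ _ h1 hij hjn hmod).trans (mul_graph_eq_beta_add_two hag hbg).symm)
    rw [hab]
    exact mul_mem ha hb

end FencePaper
end

section
/- Let n be even. For all α, β ∈ G ∖ {id} with α ≠ β and {α, β} ≠ {σ₁, σ₂}, the product αβ has rank n − 2. Moreover, rank(σ₁σ₁) = rank(σ₂σ₂) = n − 2. -/
/-!
Common framework: partial injections on `X_n = {1, …, n}`, the fence order,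
fence-preserving partial injections, the semigroups `PFI_n`, `IF_n`,
the set `J` of elements of rank at least `n - 2`, and (for even `n`)
the generating system `G`.
-/

namespace FencePaper

open PartialInj

namespace PartialInj

variable {n : ℕ}

theorem ncard_imageOf (β : PartialInj n) {S : Set ℕ} (hS : S ⊆ β.dom) :
    (β.imageOf S).ncard = S.ncard := by
  choose f hf using hS
  symm
  refine Set.ncard_congr (fun x hx => f hx) (fun x hx => ⟨x, hx, hf hx⟩) ?_ ?_
  · intro x y hx hy h
    exact β.injOn _ (hf hx) _ (hf hy) h
  · rintro z ⟨x, hx, hxz⟩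
    exact ⟨x, hx, β.functional _ (hf hx) _ hxz rfl⟩

theorem im_mul (α β : PartialInj n) : (α * β).im = β.imageOf (α.im ∩ β.dom) := by
  ext z
  constructor
  · rintro ⟨x, y, hxy, hyz⟩
    exact ⟨y, ⟨⟨x, hxy⟩, ⟨z, hyz⟩⟩, hyz⟩
  · rintro ⟨y, ⟨⟨x, hxy⟩, -⟩, hyz⟩
    exact ⟨x, y, hxy, hyz⟩

/-- `α` is a partial injection of rank `n - 1` whose domain misses exactly `d` and whose
image misses exactly `e`. -/
def Misses (α : PartialInj n) (d e : ℕ) : Prop :=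
  (d ∈ Set.Icc 1 n ∧ α.dom = Set.Icc 1 n \ {d}) ∧ (e ∈ Set.Icc 1 n ∧ α.im = Set.Icc 1 n \ {e})

theorem rank_mul_of_misses {α β : PartialInj n} {a b c d : ℕ} (hα : α.Misses a b)
    (hβ : β.Misses c d) (hbc : b ≠ c) : (α * β).rank = n - 2 := by
  obtain ⟨-, hb, hαim⟩ := hα
  obtain ⟨⟨hc, hβdom⟩, -⟩ := hβ
  have hset : α.im ∩ β.dom = Set.Icc 1 n \ {b, c} := by
    rw [hαim, hβdom]
    ext x
    simp only [Set.mem_inter_iff, Set.mem_sdiff, Set.mem_singleton_iff, Set.mem_insert_iff]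
    tauto
  have hsub : ({b, c} : Set ℕ) ⊆ Set.Icc 1 n := by
    rintro x (rfl | rfl) <;> assumption
  rw [rank, im_mul, ncard_imageOf _ Set.inter_subset_right, hset, Set.ncard_sdiff hsub,
    Set.ncard_pair hbc, Set.ncard_eq_toFinset_card']
  simp

/-- A partial injection given by a rule `f` on the complement of `d`, with inverse rule `g` on the
complement of `e`, misses `d` and `e`. -/
theorem misses_of_graph {α : PartialInj n} {d e : ℕ} (f g : ℕ → ℕ)
    (hα : α.graph = {q | 1 ≤ q.1 ∧ q.1 ≤ n ∧ q.1 ≠ d ∧ q.2 = f q.1})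
    (hd : 1 ≤ d ∧ d ≤ n) (he : 1 ≤ e ∧ e ≤ n)
    (hf : ∀ x, 1 ≤ x → x ≤ n → x ≠ d → f x ≠ e)
    (hg : ∀ y, 1 ≤ y → y ≤ n → y ≠ e → 1 ≤ g y ∧ g y ≤ n ∧ g y ≠ d ∧ y = f (g y)) :
    α.Misses d e := by
  refine ⟨⟨hd, ?_⟩, he, ?_⟩
  · ext x
    simp only [dom, hα, Set.mem_ofPred_eq, Set.mem_sdiff, Set.mem_Icc, Set.mem_singleton_iff]
    constructor
    · rintro ⟨y, h1, h2, h3, -⟩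
      exact ⟨⟨h1, h2⟩, h3⟩
    · rintro ⟨⟨h1, h2⟩, h3⟩
      exact ⟨f x, h1, h2, h3, rfl⟩
  · ext y
    constructor
    · rintro ⟨x, hxy⟩
      obtain ⟨-, -, hy⟩ := α.mem_le _ hxy
      rw [hα] at hxy
      obtain ⟨h1, h2, h3, h4⟩ := hxy
      exact ⟨hy, fun h => hf x h1 h2 h3 (h4.symm.trans h)⟩
    · rintro ⟨⟨h1, h2⟩, h3⟩
      refine ⟨g y, ?_⟩
      rw [hα]
      exact hg y h1 h2 h3

theorem misses_sigma1 {σ : PartialInj n} (hn : 2 ≤ n) (hσ : σ.graph = sigma1Graph n) :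
    σ.Misses 2 (n - 1) := by
  refine misses_of_graph (fun x => if x = 1 then n else x - 2)
    (fun y => if y = n then 1 else y + 2) hσ (by omega) (by omega) ?_ ?_
  · intro x h1 h2 h3
    split_ifs <;> omega
  · intro y h1 h2 h3
    split_ifs <;> omega

theorem misses_sigma2 {σ : PartialInj n} (hn : 2 ≤ n) (hσ : σ.graph = sigma2Graph n) :
    σ.Misses (n - 1) 2 := by
  refine misses_of_graph (fun x => if x = n then 1 else x + 2)
    (fun y => if y = 1 then n else y - 2) hσ (by omega) (by omega) ?_ ?_
  · intro x h1 h2 h3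
    split_ifs <;> omega
  · intro y h1 h2 h3
    split_ifs <;> omega

theorem misses_gamma {γ : PartialInj n} {i : ℕ} (hi : 1 ≤ i ∧ i ≤ n)
    (hγ : γ.graph = gammaGraph n i) : γ.Misses i i := by
  refine misses_of_graph (fun x => if x < i then i - x else x)
    (fun y => if y < i then i - y else y) hγ hi hi ?_ ?_
  · intro x h1 h2 h3
    split_ifs <;> omega
  · intro y h1 h2 h3
    split_ifs <;> omega

theorem misses_delta {δ : PartialInj n} {i : ℕ} (hi : 1 ≤ i ∧ i ≤ n)
    (hδ : δ.graph = deltaGraph n i) : δ.Misses i i := by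
  refine misses_of_graph (fun x => if x < i then x else n + i + 1 - x)
    (fun y => if y < i then y else n + i + 1 - y) hδ hi hi ?_ ?_
  · intro x h1 h2 h3
    split_ifs <;> omega
  · intro y h1 h2 h3
    split_ifs <;> omega

end PartialInj

/-- Products of distinct elements of `G ∖ {id}` (other than `σ₁σ₂`, `σ₂σ₁`) have
rank `n - 2`, and so do `σ₁²` and `σ₂²`. -/
theorem prod_rank (n : ℕ) (hn : Even n) (hn0 : 0 < n)
    (σ₁ σ₂ : PartialInj n) (γ δ : ℕ → PartialInj n)
    (hσ₁ : σ₁.graph = sigma1Graph n) (hσ₂ : σ₂.graph = sigma2Graph n)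
    (hγ : ∀ i, Even i → 4 ≤ i → i ≤ n → (γ i).graph = gammaGraph n i)
    (hδ : ∀ i, Odd i → i ≤ n - 3 → (δ i).graph = deltaGraph n i) :
    (∀ α ∈ Gset n σ₁ σ₂ γ δ, ∀ β ∈ Gset n σ₁ σ₂ γ δ,
      α ≠ pid n (Set.Icc 1 n) → β ≠ pid n (Set.Icc 1 n) → α ≠ β →
      ¬(α = σ₁ ∧ β = σ₂) → ¬(α = σ₂ ∧ β = σ₁) →
      (α * β).rank = n - 2) ∧
    (σ₁ * σ₁).rank = n - 2 ∧ (σ₂ * σ₂).rank = n - 2 := by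
  have hn2 : 2 ≤ n := by
    obtain ⟨k, rfl⟩ := hn
    omega
  have m₁ := misses_sigma1 hn2 hσ₁
  have m₂ := misses_sigma2 hn2 hσ₂
  have mγ : ∀ i, Even i → 4 ≤ i → i ≤ n → (γ i).Misses i i := fun i h1 h2 h3 =>
    misses_gamma ⟨by omega, h3⟩ (hγ i h1 h2 h3)
  have mδ : ∀ i, Odd i → i ≤ n - 3 → (δ i).Misses i i := fun i h1 h2 =>
    misses_delta ⟨h1.pos, by omega⟩ (hδ i h1 h2)
  simp only [Nat.even_iff, Nat.odd_iff] at hn mγ mδ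
  refine ⟨?_, rank_mul_of_misses m₁ m₁ (by omega), rank_mul_of_misses m₂ m₂ (by omega)⟩
  intro α hα β hβ hα1 hβ1 hne h12 h21
  simp only [Gset, Set.mem_union, Set.mem_insert_iff, Set.mem_singleton_iff, Set.mem_ofPred_eq,
    hα1, hβ1, false_or, Nat.even_iff, Nat.odd_iff] at hα hβ
  rcases hα with ((rfl | rfl) | ⟨i, hi1, hi2, hi3, rfl⟩) | ⟨i, hi1, hi2, rfl⟩ <;>
    rcases hβ with ((rfl | rfl) | ⟨j, hj1, hj2, hj3, rfl⟩) | ⟨j, hj1, hj2, rfl⟩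
  · exact absurd rfl hne
  · exact absurd ⟨rfl, rfl⟩ h12
  · exact rank_mul_of_misses m₁ (mγ j hj1 hj2 hj3) (by omega)
  · exact rank_mul_of_misses m₁ (mδ j hj1 hj2) (by omega)
  · exact absurd ⟨rfl, rfl⟩ h21
  · exact absurd rfl hne
  · exact rank_mul_of_misses m₂ (mγ j hj1 hj2 hj3) (by omega)
  · exact rank_mul_of_misses m₂ (mδ j hj1 hj2) (by omega)
  · exact rank_mul_of_misses (mγ i hi1 hi2 hi3) m₁ (by omega)
  · exact rank_mul_of_misses (mγ i hi1 hi2 hi3) m₂ (by omega)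
  · exact rank_mul_of_misses (mγ i hi1 hi2 hi3) (mγ j hj1 hj2 hj3) fun h => hne (h ▸ rfl)
  · exact rank_mul_of_misses (mγ i hi1 hi2 hi3) (mδ j hj1 hj2) (by omega)
  · exact rank_mul_of_misses (mδ i hi1 hi2) m₁ (by omega)
  · exact rank_mul_of_misses (mδ i hi1 hi2) m₂ (by omega)
  · exact rank_mul_of_misses (mδ i hi1 hi2) (mγ j hj1 hj2 hj3) (by omega)
  · exact rank_mul_of_misses (mδ i hi1 hi2) (mδ j hj1 hj2) fun h => hne (h ▸ rfl)
end FencePaper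
end
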